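/- arXiv:1807.05405 — 9 statements merged into one kernel-verified Lean document; each statement's English description precedes it below -/
import Mathlib

section
/- Let T_0, T_1, …, T_M be exchangeable real-valued random variables (i.e., the joint distribution of (T_0, T_1, …, T_M) is invariant under every permutation of the M+1 coordinates). Define the p-value p = (1 + #{m ∈ {1,…,M} : T_m ≥ T_0}) / (1 + M). Then for every α ∈ [0,1], P(p ≤ α) ≤ α. -/
open MeasureTheory

/-- The number of coordinates of `x` that are at least `x i`. -/
noncomputable def upperRank {ι : Type*} [Fintype ι] (x : ι → ℝ) (i : ι) : ℕ :=
  (Finset.univ.filter fun j => x i ≤ x j).card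

theorem upperRank_comp_perm {ι : Type*} [Fintype ι] (x : ι → ℝ) (σ : Equiv.Perm ι) (i : ι) :
    upperRank (fun j => x (σ j)) i = upperRank x (σ i) := by
  unfold upperRank
  exact Finset.card_equiv σ (by simp)

theorem measurable_upperRank {ι : Type*} [Fintype ι] (i : ι) :
    Measurable fun x : ι → ℝ => upperRank x i := by
  simp only [upperRank, Finset.card_filter]
  exact Finset.measurable_sum _ fun j _ => Measurable.ite
    (measurableSet_le (measurable_pi_apply i) (measurable_pi_apply j))
    measurable_const measurable_const

theorem measurableSet_upperRank_le {ι : Type*} [Fintype ι] (i : ι) (c : ℝ) :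
    MeasurableSet {x : ι → ℝ | (upperRank x i : ℝ) ≤ c} :=
  measurable_upperRank i (MeasurableSet.of_discrete (s := {n : ℕ | (n : ℝ) ≤ c}))

theorem card_upperRank_le {ι : Type*} [Fintype ι] (x : ι → ℝ) {c : ℝ} (hc : 0 ≤ c) :
    ((Finset.univ.filter fun i => (upperRank x i : ℝ) ≤ c).card : ℝ) ≤ c := by
  rcases (Finset.univ.filter fun i => (upperRank x i : ℝ) ≤ c).eq_empty_or_nonempty with h | h
  · simpa [h] using hc
  · obtain ⟨i, hi, hmin⟩ := Finset.exists_min_image _ x h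
    refine le_trans ?_ (Finset.mem_filter.1 hi).2
    exact_mod_cast Finset.card_le_card fun j hj => by simpa using hmin j hj

theorem upperRank_zero {M : ℕ} (x : Fin (M + 1) → ℝ) :
    upperRank x 0 = 1 + (Finset.univ.filter fun m : Fin M => x 0 ≤ x m.succ).card := by
  simp [upperRank, Fin.card_filter_univ_succ, add_comm]

/-- An exchangeable law gives the event that a fixed coordinate has upper rank at most `c`
probability at most `c` divided by the number of coordinates. -/
theorem card_mul_measure_upperRank_le {ι : Type*} [Fintype ι]
    (μ : Measure (ι → ℝ)) [IsProbabilityMeasure μ]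
    (hμ : ∀ σ : Equiv.Perm ι, μ.map (fun x i => x (σ i)) = μ)
    {c : ℝ} (hc : 0 ≤ c) (i : ι) :
    (Fintype.card ι : ENNReal) * μ {x | (upperRank x i : ℝ) ≤ c} ≤ ENNReal.ofReal c := by
  classical
  have hsymm (j : ι) :
      μ {x | (upperRank x j : ℝ) ≤ c} = μ {x | (upperRank x i : ℝ) ≤ c} := by
    conv_rhs => rw [← hμ (Equiv.swap i j)]
    rw [Measure.map_apply (by fun_prop) (measurableSet_upperRank_le i c)]
    simp [upperRank_comp_perm]
  calc (Fintype.card ι : ENNReal) * μ {x | (upperRank x i : ℝ) ≤ c}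
      = ∑ j, μ {x | (upperRank x j : ℝ) ≤ c} := by simp [hsymm]
    _ = ∫⁻ x, ∑ j, {x | (upperRank x j : ℝ) ≤ c}.indicator 1 x ∂μ := by
      rw [lintegral_finsetSum _ fun j _ =>
        measurable_one.indicator (measurableSet_upperRank_le j c)]
      simp [lintegral_indicator_one (measurableSet_upperRank_le _ c)]
    _ ≤ ∫⁻ _, ENNReal.ofReal c ∂μ := by
      refine lintegral_mono fun x => ?_
      have h := ENNReal.ofReal_le_ofReal (card_upperRank_le x hc)
      rw [ENNReal.ofReal_natCast] at h
      simpa [Set.indicator_apply] using h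
    _ = ENNReal.ofReal c := by simp

/-- **Validity of the p-value for exchangeable statistics.**
If `T 0, T 1, …, T M` are exchangeable real-valued random variables, then the p-value
`p = (1 + #{m ∈ {1,…,M} : T m ≥ T 0}) / (1 + M)` satisfies `P(p ≤ α) ≤ α` for all `α ∈ [0,1]`. -/
theorem pvalue_exchangeable_valid {Ω : Type*} [MeasurableSpace Ω]
    (P : Measure Ω) [IsProbabilityMeasure P]
    (M : ℕ) (T : Fin (M + 1) → Ω → ℝ) (hT : ∀ i, Measurable (T i))
    (hexch : ∀ σ : Equiv.Perm (Fin (M + 1)),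
      P.map (fun ω => fun i => T (σ i) ω) = P.map (fun ω => fun i => T i ω))
    (α : ℝ) (hα : α ∈ Set.Icc (0 : ℝ) 1) :
    P {ω | (1 + ((Finset.univ.filter fun m : Fin M => T 0 ω ≤ T m.succ ω).card) : ℝ) / (1 + M)
        ≤ α} ≤ ENNReal.ofReal α := by
  have hmeas : Measurable fun ω i => T i ω := measurable_pi_lambda _ hT
  have : IsProbabilityMeasure (P.map fun ω i => T i ω) :=
    Measure.isProbabilityMeasure_map hmeas.aemeasurable
  have hM : (0 : ℝ) < 1 + M := by positivity
  have h := card_mul_measure_upperRank_le (P.map fun ω i => T i ω)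
    (fun σ => by
      rw [Measure.map_map (by fun_prop) hmeas]
      exact hexch σ)
    (mul_nonneg hM.le hα.1) 0
  rw [Measure.map_apply hmeas (measurableSet_upperRank_le 0 _), ENNReal.ofReal_mul hM.le,
    show ENNReal.ofReal (1 + M) = (Fintype.card (Fin (M + 1)) : ENNReal) by
      rw [Fintype.card_fin, ← ENNReal.ofReal_natCast]
      push_cast
      rw [add_comm],
    ENNReal.mul_le_mul_iff_right (by simp) (by simp)] at h
  simpa only [div_le_iff₀' hM, Set.preimage_ofPred_eq, upperRank_zero, Nat.cast_add,
    Nat.cast_one] using h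
end

section
/- Let (X_i, Y_i, Z_i), i = 1,…,n, be i.i.d. random triples with values in 𝒳 × 𝒴 × 𝒵, where 𝒳 is a measurable space equipped with a σ-finite measure ν₀. Assume the null hypothesis H₀: X_i is conditionally independent of Y_i given Z_i, and that the conditional distribution of X_i given Z_i = z has density q(·|z) with respect to ν₀ for every z. Write X = (X_1,…,X_n), Y = (Y_1,…,Y_n), Z = (Z_1,…,Z_n), and assume that almost surely Σ_{π ∈ S_n} Π_{i=1}^n q(X_{π(i)}|Z_i) > 0. Conditional on (X, Y, Z), let π^(1),…,π^(M) be i.i.d. permutations in S_n drawn with probabilities P(π^(m) = π | X, Y, Z) = Π_{i=1}^n q(X_{π(i)}|Z_i) / Σ_{π' ∈ S_n} Π_{i=1}^n q(X_{π'(i)}|Z_i), and set X^(m) = (X_{π^(m)(1)},…,X_{π^(m)(n)}). Then the M+1 triples (X, Y, Z), (X^(1), Y, Z), …, (X^(M), Y, Z) are exchangeable, and consequently for every measurable statistic T : 𝒳ⁿ × 𝒴ⁿ × 𝒵ⁿ → ℝ, the p-value p = (1 + Σ_{m=1}^M 1{T(X^(m), Y, Z) ≥ T(X, Y, Z)}) /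 (1 + M) satisfies P(p ≤ α) ≤ α for every α ∈ [0,1]. -/
open MeasureTheory
open scoped ENNReal NNReal

instance (n : ℕ) : MeasurableSpace (Equiv.Perm (Fin n)) := ⊤

/-- CPT permutation weight `Π_{i=1}^n q(X_{π(i)} | Z_i)` for a data vector
`d : Fin n → 𝒵 × 𝒳 × 𝒴` (so `Z_i = (d i).1`, `X_i = (d i).2.1`, `Y_i = (d i).2.2`). -/
noncomputable def cptWeight {𝒳 𝒴 𝒵 : Type*} (n : ℕ) (q : 𝒳 → 𝒵 → ℝ≥0)
    (d : Fin n → 𝒵 × 𝒳 × 𝒴) (π : Equiv.Perm (Fin n)) : ℝ≥0∞ :=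
  ∏ i, (q ((d (π i)).2.1) ((d i).1) : ℝ≥0∞)

/-- The CPT distribution on permutations: `P(π) ∝ Π_i q(X_{π(i)} | Z_i)`. -/
noncomputable def cptPermMeasure {𝒳 𝒴 𝒵 : Type*} (n : ℕ) (q : 𝒳 → 𝒵 → ℝ≥0)
    (d : Fin n → 𝒵 × 𝒳 × 𝒴) : Measure (Equiv.Perm (Fin n)) :=
  ∑ π : Equiv.Perm (Fin n),
    (cptWeight n q d π / ∑ π' : Equiv.Perm (Fin n), cptWeight n q d π') • Measure.dirac π

open ProbabilityTheory

instance (n : ℕ) : MeasurableSingletonClass (Equiv.Perm (Fin n)) := ⟨fun _ => trivial⟩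

/-! ### Product measures and densities -/

theorem lintegral_pi_fin_prod_eq_prod {E : Type*} [MeasurableSpace E] (μ : Measure E)
    [SigmaFinite μ] {n : ℕ} (f : Fin n → E → ℝ≥0∞) (hf : ∀ i, Measurable (f i)) :
    ∫⁻ x, ∏ i, f i (x i) ∂(Measure.pi fun _ : Fin n => μ) = ∏ i, ∫⁻ x, f i x ∂μ := by
  induction n with
  | zero => simp
  | succ n ih =>
    have h := (measurePreserving_piFinSuccAbove (fun _ : Fin (n + 1) => μ) 0).symm
    rw [← h.lintegral_comp (by fun_prop)]
    simp_rw [MeasurableEquiv.piFinSuccAbove_symm_apply, Fin.insertNthEquiv, Fin.prod_univ_succ,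
      Fin.insertNth_zero, Equiv.coe_fn_mk, Fin.cons_succ, cast_eq, Fin.cons_zero]
    rw [← ih _ fun i => hf i.succ]
    have hg : Measurable fun y : Fin n → E => ∏ i, f i.succ (y i) :=
      Finset.measurable_prod _ fun i _ => (hf i.succ).comp (measurable_pi_apply i)
    exact lintegral_prod_mul (hf 0).aemeasurable hg.aemeasurable

theorem pi_withDensity {E : Type*} [MeasurableSpace E] (μ : Measure E) [SigmaFinite μ] (n : ℕ)
    (f : E → ℝ≥0∞) (hf : Measurable f) [SigmaFinite (μ.withDensity f)] :
    (Measure.pi fun _ : Fin n => μ.withDensity f)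
      = (Measure.pi fun _ : Fin n => μ).withDensity fun x => ∏ i, f (x i) := by
  refine Measure.pi_eq fun s hs => ?_
  have hpi : MeasurableSet (Set.univ.pi s) := .univ_pi hs
  simp_rw [withDensity_apply _ hpi, withDensity_apply _ (hs _), ← lintegral_indicator hpi,
    ← lintegral_indicator (hs _)]
  rw [← lintegral_pi_fin_prod_eq_prod μ (fun i => (s i).indicator f) fun i => hf.indicator (hs i)]
  refine lintegral_congr fun x => ?_
  by_cases hx : x ∈ Set.univ.pi s
  · rw [Set.indicator_of_mem hx]
    exact Finset.prod_congr rfl fun i _ => (Set.indicator_of_mem (hx i trivial) f).symm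
  · rw [Set.indicator_of_notMem hx]
    obtain ⟨i, hi⟩ : ∃ i, x i ∉ s i := by simpa [Set.mem_pi] using hx
    exact (Finset.prod_eq_zero (Finset.mem_univ i) (Set.indicator_of_notMem hi f)).symm

/-- Reassembling a covariate vector and a vector of (confounder, response) pairs into a data
vector. -/
def assemble {𝒳 𝒴 𝒵 : Type*} {n : ℕ} (e : (Fin n → 𝒳) × (Fin n → 𝒵 × 𝒴)) :
    Fin n → 𝒵 × 𝒳 × 𝒴 :=
  fun i => ((e.2 i).1, e.1 i, (e.2 i).2)

section
variable {𝒳 𝒴 𝒵 : Type*} [MeasurableSpace 𝒳] [MeasurableSpace 𝒴] [MeasurableSpace 𝒵]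

theorem measurable_assemble {n : ℕ} :
    Measurable (assemble : (Fin n → 𝒳) × (Fin n → 𝒵 × 𝒴) → Fin n → 𝒵 × 𝒳 × 𝒴) := by
  unfold assemble
  fun_prop

theorem pi_eq_map_assemble (ν : Measure 𝒳) [SigmaFinite ν] (ρ : Measure (𝒵 × 𝒴)) [SigmaFinite ρ]
    (n : ℕ) (q : 𝒳 → 𝒵 → ℝ≥0) (hq : Measurable fun p : 𝒳 × 𝒵 => q p.1 p.2) :
    (Measure.pi fun _ : Fin n =>
      ((ν.prod ρ).map fun a => (a.2.1, a.1, a.2.2)).withDensity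
        fun p => (q p.2.1 p.1 : ℝ≥0∞))
      = (((Measure.pi fun _ : Fin n => ν).prod (Measure.pi fun _ : Fin n => ρ)).map
          assemble).withDensity fun d => cptWeight n q d 1 := by
  let e : 𝒳 × 𝒵 × 𝒴 ≃ᵐ 𝒵 × 𝒳 × 𝒴 :=
    { toFun := fun a => (a.2.1, a.1, a.2.2)
      invFun := fun a => (a.2.1, a.1, a.2.2)
      left_inv := fun _ => rfl
      right_inv := fun _ => rfl
      measurable_toFun := by dsimp; fun_prop
      measurable_invFun := by dsimp; fun_prop }
  have : SigmaFinite ((ν.prod ρ).map fun a : 𝒳 × 𝒵 × 𝒴 => (a.2.1, a.1, a.2.2)) :=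
    e.sigmaFinite_map
  have : SigmaFinite (((ν.prod ρ).map fun a : 𝒳 × 𝒵 × 𝒴 => (a.2.1, a.1, a.2.2)).withDensity
      fun p => (q p.2.1 p.1 : ℝ≥0∞)) :=
    SigmaFinite.withDensity fun p : 𝒵 × 𝒳 × 𝒴 => q p.2.1 p.1
  have hm : Measurable fun p : 𝒵 × 𝒳 × 𝒴 => (q p.2.1 p.1 : ℝ≥0∞) :=
    (hq.comp (by fun_prop : Measurable fun p : 𝒵 × 𝒳 × 𝒴 => (p.2.1, p.1))).coe_nnreal_ennreal
  rw [pi_withDensity _ _ _ hm]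
  congr 1
  have h₁ := (measurePreserving_arrowProdEquivProdArrow 𝒳 (𝒵 × 𝒴) (Fin n)
    (fun _ => ν) (fun _ => ρ)).symm
  have h₂ := measurePreserving_pi (fun _ : Fin n => ν.prod ρ)
    (fun _ => (ν.prod ρ).map fun a : 𝒳 × 𝒵 × 𝒴 => (a.2.1, a.1, a.2.2))
    fun _ => (e.measurable.measurePreserving (ν.prod ρ))
  exact (h₂.comp h₁).map_eq.symm

theorem bind_eq_withDensity (ν₀ : Measure 𝒳) [SigmaFinite ν₀] (μZ : Measure 𝒵)
    [IsProbabilityMeasure μZ] (κ : Kernel 𝒵 𝒴) [IsMarkovKernel κ]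
    (q : 𝒳 → 𝒵 → ℝ≥0) (hq : Measurable fun p : 𝒳 × 𝒵 => q p.1 p.2)
    (hq1 : ∀ zv, ∫⁻ x, (q x zv : ℝ≥0∞) ∂ν₀ = 1) :
    ((μZ.bind fun zv =>
      (((ν₀.withDensity fun x => (q x zv : ℝ≥0∞)).prod (κ zv)).map fun xy => (zv, xy.1, xy.2)))
      = ((ν₀.prod (μZ ⊗ₘ κ)).map fun a => (a.2.1, a.1, a.2.2)).withDensity
        fun p => (q p.2.1 p.1 : ℝ≥0∞))
    ∧ IsProbabilityMeasure (μZ.bind fun zv =>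
      (((ν₀.withDensity fun x => (q x zv : ℝ≥0∞)).prod (κ zv)).map
        fun xy => (zv, xy.1, xy.2))) := by
  have hq' : Measurable (Function.uncurry fun z x => (q x z : ℝ≥0∞)) :=
    (hq.comp measurable_swap).coe_nnreal_ennreal
  let κX : Kernel 𝒵 𝒳 := (Kernel.const 𝒵 ν₀).withDensity fun z x => (q x z : ℝ≥0∞)
  have hκX (z : 𝒵) : κX z = ν₀.withDensity fun x => (q x z : ℝ≥0∞) := by
    rw [Kernel.withDensity_apply _ hq', Kernel.const_apply]
  have : IsMarkovKernel κX := ⟨fun z => ⟨by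
    rw [hκX, withDensity_apply _ .univ, Measure.restrict_univ, hq1]⟩⟩
  have hbind : (μZ.bind fun zv =>
      (((ν₀.withDensity fun x => (q x zv : ℝ≥0∞)).prod (κ zv)).map fun xy => (zv, xy.1, xy.2)))
      = μZ ⊗ₘ (κX ×ₖ κ) := by
    rw [Measure.compProd_eq_comp_prod]
    congr 1
    ext1 z
    rw [Kernel.prod_apply, Kernel.id_apply, Measure.dirac_prod, Kernel.prod_apply, hκX]
  rw [hbind]
  refine ⟨?_, inferInstance⟩
  have hm : Measurable fun p : 𝒵 × 𝒳 × 𝒴 => (q p.2.1 p.1 : ℝ≥0∞) :=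
    (hq.comp (by fun_prop : Measurable fun p : 𝒵 × 𝒳 × 𝒴 => (p.2.1, p.1))).coe_nnreal_ennreal
  refine Measure.ext_of_lintegral _ fun f hf => ?_
  have hmf : Measurable fun a : 𝒳 × 𝒵 × 𝒴 =>
      ((fun p : 𝒵 × 𝒳 × 𝒴 => (q p.2.1 p.1 : ℝ≥0∞)) * f) (a.2.1, a.1, a.2.2) :=
    (hm.mul hf).comp (by fun_prop)
  rw [lintegral_withDensity_eq_lintegral_mul _ hm hf,
    lintegral_map (hm.mul hf) (by fun_prop), lintegral_prod_symm _ hmf.aemeasurable,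
    Measure.lintegral_compProd hf, Measure.lintegral_compProd]
  · refine lintegral_congr fun z => ?_
    rw [Kernel.lintegral_prod_symm _ _ _ (by fun_prop)]
    refine lintegral_congr fun y => ?_
    have hqz : Measurable fun x => (q x z : ℝ≥0∞) := hq'.comp measurable_prodMk_left
    rw [hκX, lintegral_withDensity_eq_lintegral_mul _ hqz (by fun_prop)]
    rfl
  · exact hmf.lintegral_prod_left'

/-! ### The permutation law -/

theorem measurable_cptWeight {n : ℕ} {q : 𝒳 → 𝒵 → ℝ≥0}
    (hq : Measurable fun p : 𝒳 × 𝒵 => q p.1 p.2) (π : Equiv.Perm (Fin n)) :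
    Measurable fun d : Fin n → 𝒵 × 𝒳 × 𝒴 => cptWeight n q d π := by
  unfold cptWeight
  refine Finset.measurable_prod _ fun i _ => Measurable.coe_nnreal_ennreal ?_
  exact hq.comp (by fun_prop : Measurable fun d : Fin n → 𝒵 × 𝒳 × 𝒴 => ((d (π i)).2.1, (d i).1))

theorem cptPermMeasure_singleton {𝒳 𝒴 𝒵 : Type*} {n : ℕ} (q : 𝒳 → 𝒵 → ℝ≥0) (d : Fin n → 𝒵 × 𝒳 × 𝒴)
    (π : Equiv.Perm (Fin n)) :
    cptPermMeasure n q d {π} = cptWeight n q d π * (∑ π', cptWeight n q d π')⁻¹ := by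
  rw [cptPermMeasure, Measure.finsetSum_apply, Finset.sum_eq_single π]
  · simp [div_eq_mul_inv]
  · intro b _ hb
    simp [hb]
  · simp

theorem cptPermMeasure_univ_le_one {𝒳 𝒴 𝒵 : Type*} {n : ℕ} (q : 𝒳 → 𝒵 → ℝ≥0) (d : Fin n → 𝒵 × 𝒳 × 𝒴) :
    cptPermMeasure n q d Set.univ ≤ 1 := by
  rw [cptPermMeasure, Measure.finsetSum_apply]
  simp only [Measure.smul_apply, measure_univ, smul_eq_mul, mul_one, div_eq_mul_inv]
  rw [← Finset.sum_mul]
  exact ENNReal.mul_inv_le_one _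

instance {𝒳 𝒴 𝒵 : Type*} {n : ℕ} (q : 𝒳 → 𝒵 → ℝ≥0) (d : Fin n → 𝒵 × 𝒳 × 𝒴) :
    IsFiniteMeasure (cptPermMeasure n q d) :=
  ⟨(cptPermMeasure_univ_le_one q d).trans_lt ENNReal.one_lt_top⟩

theorem map_pi_cptPermMeasure {n : ℕ} (M : ℕ) (q : 𝒳 → 𝒵 → ℝ≥0) (d : Fin n → 𝒵 × 𝒳 × 𝒴) :
    (Measure.pi fun _ : Fin M => cptPermMeasure n q d).map (fun πs => (d, πs))
      = ∑ πs : Fin M → Equiv.Perm (Fin n),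
        (∏ m, cptWeight n q d (πs m) * (∑ π', cptWeight n q d π')⁻¹) •
          Measure.dirac (d, πs) := by
  conv_lhs => rw [← Measure.sum_smul_dirac (Measure.pi fun _ : Fin M => cptPermMeasure n q d)]
  rw [Measure.sum_fintype, Measure.map_finset_sum measurable_prodMk_left.aemeasurable]
  refine Finset.sum_congr rfl fun πs _ => ?_
  rw [Measure.map_smul, Measure.map_dirac' measurable_prodMk_left, Measure.pi_singleton]
  simp_rw [cptPermMeasure_singleton]

theorem measurable_map_pi_cptPermMeasure {n : ℕ} (M : ℕ) {q : 𝒳 → 𝒵 → ℝ≥0}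
    (hq : Measurable fun p : 𝒳 × 𝒵 => q p.1 p.2) :
    Measurable fun d : Fin n → 𝒵 × 𝒳 × 𝒴 =>
      (Measure.pi fun _ : Fin M => cptPermMeasure n q d).map fun πs => (d, πs) := by
  have hw := fun π => measurable_cptWeight (𝒴 := 𝒴) (n := n) hq π
  simp_rw [map_pi_cptPermMeasure]
  refine Measure.measurable_of_measurable_coe _ fun s hs => ?_
  simp only [Measure.finsetSum_apply, Measure.smul_apply, smul_eq_mul, Measure.dirac_apply' _ hs]
  refine Finset.measurable_sum _ fun πs _ => Measurable.mul (by fun_prop) ?_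
  exact (measurable_one.indicator hs).comp measurable_prodMk_right

theorem lintegral_bind_cptPermMeasure {n : ℕ} (M : ℕ) {q : 𝒳 → 𝒵 → ℝ≥0}
    (hq : Measurable fun p : 𝒳 × 𝒵 => q p.1 p.2) (μ : Measure (Fin n → 𝒵 × 𝒳 × 𝒴))
    {f : (Fin n → 𝒵 × 𝒳 × 𝒴) × (Fin M → Equiv.Perm (Fin n)) → ℝ≥0∞} (hf : Measurable f) :
    ∫⁻ ω, f ω ∂(μ.bind fun d =>
        (Measure.pi fun _ : Fin M => cptPermMeasure n q d).map fun πs => (d, πs))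
      = ∫⁻ d, ∑ πs : Fin M → Equiv.Perm (Fin n),
        (∏ m, cptWeight n q d (πs m) * (∑ π', cptWeight n q d π')⁻¹) * f (d, πs) ∂μ := by
  rw [Measure.lintegral_bind (measurable_map_pi_cptPermMeasure M hq).aemeasurable
    hf.aemeasurable]
  refine lintegral_congr fun d => ?_
  rw [map_pi_cptPermMeasure, lintegral_finsetSum_measure]
  refine Finset.sum_congr rfl fun πs _ => ?_
  rw [lintegral_smul_measure, lintegral_dirac' _ hf, smul_eq_mul]

theorem bind_cptPermMeasure_univ_le_one {n : ℕ} (M : ℕ) {q : 𝒳 → 𝒵 → ℝ≥0}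
    (hq : Measurable fun p : 𝒳 × 𝒵 => q p.1 p.2) (μ : Measure (Fin n → 𝒵 × 𝒳 × 𝒴))
    [IsProbabilityMeasure μ] :
    (μ.bind fun d =>
      (Measure.pi fun _ : Fin M => cptPermMeasure n q d).map fun πs => (d, πs)) Set.univ ≤ 1 := by
  rw [Measure.bind_apply .univ (measurable_map_pi_cptPermMeasure M hq).aemeasurable]
  refine (lintegral_mono (g := fun _ => 1) fun d => ?_).trans (by simp)
  rw [Measure.map_apply measurable_prodMk_left .univ, Set.preimage_univ, Measure.pi_univ]
  exact Finset.prod_le_one' fun _ _ => cptPermMeasure_univ_le_one q d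

/-! ### Exchangeability -/

/-- The triple `(X_π, Y, Z)` read off from a data vector. -/
def permTriple {𝒳 𝒴 𝒵 : Type*} {n : ℕ} (d : Fin n → 𝒵 × 𝒳 × 𝒴) (π : Equiv.Perm (Fin n)) :
    (Fin n → 𝒳) × (Fin n → 𝒴) × (Fin n → 𝒵) :=
  (fun i => (d (π i)).2.1, fun i => (d i).2.2, fun i => (d i).1)

theorem measurable_permTriple {n : ℕ} (π : Equiv.Perm (Fin n)) :
    Measurable fun d : Fin n → 𝒵 × 𝒳 × 𝒴 => permTriple d π := by
  unfold permTriple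
  fun_prop

/-- The original triple followed by its `M` permuted copies. -/
def permTriples {𝒳 𝒴 𝒵 : Type*} {n M : ℕ}
    (ω : (Fin n → 𝒵 × 𝒳 × 𝒴) × (Fin M → Equiv.Perm (Fin n))) (m : Fin (M + 1)) :
    (Fin n → 𝒳) × (Fin n → 𝒴) × (Fin n → 𝒵) :=
  permTriple ω.1 ((Fin.cons (Equiv.refl (Fin n)) ω.2 : Fin (M + 1) → Equiv.Perm (Fin n)) m)

theorem measurable_permTriples {n M : ℕ} :
    Measurable (permTriples :
      (Fin n → 𝒵 × 𝒳 × 𝒴) × (Fin M → Equiv.Perm (Fin n)) → Fin (M + 1) →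
        (Fin n → 𝒳) × (Fin n → 𝒴) × (Fin n → 𝒵)) := by
  refine measurable_from_prod_countable_left fun πs => measurable_pi_iff.2 fun m => ?_
  exact measurable_permTriple
    ((Fin.cons (Equiv.refl (Fin n)) πs : Fin (M + 1) → Equiv.Perm (Fin n)) m)

/-- The unnormalized joint weight of `M + 1` permutations, times a function of the corresponding
permuted triples. -/
noncomputable def jointTerm {𝒳 𝒴 𝒵 : Type*} {n M : ℕ} (q : 𝒳 → 𝒵 → ℝ≥0)
    (g : (Fin (M + 1) → (Fin n → 𝒳) × (Fin n → 𝒴) × (Fin n → 𝒵)) → ℝ≥0∞)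
    (d : Fin n → 𝒵 × 𝒳 × 𝒴) (ρ : Fin (M + 1) → Equiv.Perm (Fin n)) : ℝ≥0∞ :=
  (∏ m, cptWeight n q d (ρ m)) * (∑ π', cptWeight n q d π')⁻¹ ^ M * g fun m => permTriple d (ρ m)

theorem measurable_jointTerm {n M : ℕ} {q : 𝒳 → 𝒵 → ℝ≥0}
    (hq : Measurable fun p : 𝒳 × 𝒵 => q p.1 p.2)
    {g : (Fin (M + 1) → (Fin n → 𝒳) × (Fin n → 𝒴) × (Fin n → 𝒵)) → ℝ≥0∞} (hg : Measurable g)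
    (ρ : Fin (M + 1) → Equiv.Perm (Fin n)) : Measurable fun d => jointTerm q g d ρ := by
  have hw := fun π => measurable_cptWeight (𝒴 := 𝒴) (n := n) hq π
  have ht := fun π => measurable_permTriple (𝒳 := 𝒳) (𝒴 := 𝒴) (𝒵 := 𝒵) (n := n) π
  unfold jointTerm
  fun_prop

theorem jointTerm_assemble_comp {𝒳 𝒴 𝒵 : Type*} {n M : ℕ} (q : 𝒳 → 𝒵 → ℝ≥0)
    (g : (Fin (M + 1) → (Fin n → 𝒳) × (Fin n → 𝒴) × (Fin n → 𝒵)) → ℝ≥0∞)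
    (e : (Fin n → 𝒳) × (Fin n → 𝒵 × 𝒴)) (τ : Equiv.Perm (Fin n))
    (ρ : Fin (M + 1) → Equiv.Perm (Fin n)) :
    jointTerm q g (assemble (fun i => e.1 (τ i), e.2)) ρ
      = jointTerm q g (assemble e) fun m => τ * ρ m := by
  have hw (π : Equiv.Perm (Fin n)) : cptWeight n q (assemble (fun i => e.1 (τ i), e.2)) π
      = cptWeight n q (assemble e) (τ * π) := rfl
  have hsum : ∑ π, cptWeight n q (assemble e) (τ * π) = ∑ π, cptWeight n q (assemble e) π :=
    Equiv.sum_comp (Equiv.mulLeft τ) fun π => cptWeight n q (assemble e) π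
  simp only [jointTerm, hw, hsum]
  rfl

theorem measurePreserving_comp_perm (ν : Measure 𝒳) [SigmaFinite ν] {n : ℕ}
    (τ : Equiv.Perm (Fin n)) :
    MeasurePreserving (fun (x : Fin n → 𝒳) i => x (τ i)) (Measure.pi fun _ => ν)
      (Measure.pi fun _ => ν) := by
  convert measurePreserving_piCongrLeft (fun _ : Fin n => ν) τ.symm using 1
  ext x i
  have h := Equiv.piCongrLeft_apply_apply (fun _ : Fin n => 𝒳) τ.symm x (τ i)
  rw [Equiv.symm_apply_apply] at h
  exact h.symm

theorem sum_jointTerm {𝒳 𝒴 𝒵 : Type*} {n M : ℕ} (q : 𝒳 → 𝒵 → ℝ≥0)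
    (g : (Fin (M + 1) → (Fin n → 𝒳) × (Fin n → 𝒴) × (Fin n → 𝒵)) → ℝ≥0∞)
    (e : (Fin n → 𝒳) × (Fin n → 𝒵 × 𝒴)) :
    ∑ τ : Equiv.Perm (Fin n), ∑ πs : Fin M → Equiv.Perm (Fin n),
        jointTerm q g (assemble (fun i => e.1 (τ i), e.2))
          (Fin.cons (1 : Equiv.Perm (Fin n)) πs : Fin (M + 1) → Equiv.Perm (Fin n))
      = ∑ ρ, jointTerm q g (assemble e) ρ := by
  rw [← (Fin.consEquiv fun _ : Fin (M + 1) => Equiv.Perm (Fin n)).sum_comp,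
    Fintype.sum_prod_type]
  refine Finset.sum_congr rfl fun τ _ => ?_
  refine Fintype.sum_equiv (Equiv.mulLeft fun _ : Fin M => τ) _ _ fun πs => ?_
  rw [jointTerm_assemble_comp]
  congr 1
  ext1 m
  refine Fin.cases ?_ (fun k => ?_) m <;> simp [Fin.consEquiv]

theorem factorial_mul_lintegral_permTriples (ν : Measure 𝒳) [SigmaFinite ν] {n M : ℕ}
    (ρ : Measure (Fin n → 𝒵 × 𝒴)) [SigmaFinite ρ] {q : 𝒳 → 𝒵 → ℝ≥0}
    (hq : Measurable fun p : 𝒳 × 𝒵 => q p.1 p.2)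
    {g : (Fin (M + 1) → (Fin n → 𝒳) × (Fin n → 𝒴) × (Fin n → 𝒵)) → ℝ≥0∞} (hg : Measurable g) :
    (Fintype.card (Equiv.Perm (Fin n)) : ℝ≥0∞) *
      ∫⁻ ω, g (permTriples ω) ∂((((Measure.pi fun _ => ν).prod ρ).map assemble).withDensity
          fun d => cptWeight n q d 1).bind (fun d =>
        (Measure.pi fun _ : Fin M => cptPermMeasure n q d).map fun πs => (d, πs))
      = ∫⁻ e, ∑ ρ, jointTerm q g (assemble e) ρ ∂(Measure.pi fun _ => ν).prod ρ := by
  have hw := fun π => measurable_cptWeight (𝒴 := 𝒴) (n := n) hq π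
  have hJ := fun ρ => measurable_jointTerm hq hg ρ
  have hA := measurable_assemble (𝒳 := 𝒳) (𝒴 := 𝒴) (𝒵 := 𝒵) (n := n)
  have hV := measurable_permTriples (𝒳 := 𝒳) (𝒴 := 𝒴) (𝒵 := 𝒵) (n := n) (M := M)
  have hstart : ∫⁻ ω, g (permTriples ω) ∂((((Measure.pi fun _ => ν).prod ρ).map
      assemble).withDensity fun d => cptWeight n q d 1).bind (fun d =>
        (Measure.pi fun _ : Fin M => cptPermMeasure n q d).map fun πs => (d, πs))
      = ∫⁻ e, ∑ πs : Fin M → Equiv.Perm (Fin n), jointTerm q g (assemble e)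
          (Fin.cons (1 : Equiv.Perm (Fin n)) πs : Fin (M + 1) → Equiv.Perm (Fin n))
          ∂(Measure.pi fun _ => ν).prod ρ := by
    have hgV : Measurable fun ω : (Fin n → 𝒵 × 𝒳 × 𝒴) × (Fin M → Equiv.Perm (Fin n)) =>
      g (permTriples ω) := hg.comp hV
    have hgV' (πs : Fin M → Equiv.Perm (Fin n)) :
        Measurable fun d : Fin n → 𝒵 × 𝒳 × 𝒴 => g (permTriples (d, πs)) :=
      hgV.comp measurable_prodMk_right
    rw [lintegral_bind_cptPermMeasure M hq _ hgV,
      lintegral_withDensity_eq_lintegral_mul _ (hw 1) (by fun_prop),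
      lintegral_map (by fun_prop) hA]
    refine lintegral_congr fun e => ?_
    rw [Pi.mul_apply, Finset.mul_sum]
    refine Finset.sum_congr rfl fun πs _ => ?_
    rw [jointTerm, Fin.prod_univ_succ, Finset.prod_mul_distrib, Finset.prod_const,
      Finset.card_univ, Fintype.card_fin]
    simp only [Fin.cons_zero, Fin.cons_succ, mul_assoc]
    rfl
  have hinv (τ : Equiv.Perm (Fin n)) := ((measurePreserving_comp_perm ν τ).prod
    (MeasurePreserving.id ρ)).lintegral_comp (f := fun e => ∑ πs : Fin M → Equiv.Perm (Fin n),
      jointTerm q g (assemble e)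
        (Fin.cons (1 : Equiv.Perm (Fin n)) πs : Fin (M + 1) → Equiv.Perm (Fin n)))
    (Finset.measurable_sum _ fun πs _ => (hJ _).comp hA)
  rw [hstart, ← Finset.card_univ, ← nsmul_eq_mul, ← Finset.sum_const]
  simp_rw [← sum_jointTerm q g]
  refine Eq.trans ?_ (lintegral_finsetSum _ fun τ _ => ?_).symm
  · exact Finset.sum_congr rfl fun τ _ => (hinv τ).symm
  · exact Finset.measurable_sum _ fun πs _ => (hJ _).comp
      (hA.comp (by fun_prop : Measurable fun e : (Fin n → 𝒳) × (Fin n → 𝒵 × 𝒴) =>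
        ((fun i => e.1 (τ i), e.2) : (Fin n → 𝒳) × (Fin n → 𝒵 × 𝒴))))

theorem map_permTriples_comp_perm (ν : Measure 𝒳) [SigmaFinite ν] {n M : ℕ}
    (ρ : Measure (Fin n → 𝒵 × 𝒴)) [SigmaFinite ρ] {q : 𝒳 → 𝒵 → ℝ≥0}
    (hq : Measurable fun p : 𝒳 × 𝒵 => q p.1 p.2) {P : Measure _}
    (hP : P = ((((Measure.pi fun _ => ν).prod ρ).map assemble).withDensity
          fun d => cptWeight n q d 1).bind (fun d =>
        (Measure.pi fun _ : Fin M => cptPermMeasure n q d).map fun πs => (d, πs)))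
    (σ : Equiv.Perm (Fin (M + 1))) :
    P.map (fun ω m => permTriples ω (σ m)) = P.map permTriples := by
  have hV := measurable_permTriples (𝒳 := 𝒳) (𝒴 := 𝒴) (𝒵 := 𝒵) (n := n) (M := M)
  have hσ : Measurable fun (v : Fin (M + 1) → (Fin n → 𝒳) × (Fin n → 𝒴) × (Fin n → 𝒵)) m =>
    v (σ m) := by fun_prop
  refine Measure.ext_of_lintegral _ fun g hg => ?_
  rw [lintegral_map hg (by exact hσ.comp hV), lintegral_map hg hV]
  have hcard : (Fintype.card (Equiv.Perm (Fin n)) : ℝ≥0∞) ≠ 0 := by simp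
  rw [← ENNReal.mul_right_inj hcard (ENNReal.natCast_ne_top _), hP,
    factorial_mul_lintegral_permTriples ν ρ hq hg,
    factorial_mul_lintegral_permTriples ν ρ hq (g := fun v => g fun m => v (σ m)) (hg.comp hσ)]
  refine lintegral_congr fun e => ?_
  rw [← (Equiv.arrowCongr σ (Equiv.refl (Equiv.Perm (Fin n)))).sum_comp]
  refine Finset.sum_congr rfl fun τ _ => ?_
  simp only [jointTerm, Equiv.arrowCongr_apply, Equiv.coe_refl, Function.comp_apply, id,
    Equiv.symm_apply_apply]
  rw [σ.symm.prod_comp fun m => cptWeight n q (assemble e) (τ m)]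

end

/-! ### Ranks of exchangeable sequences -/

theorem card_filter_card_filter_le {ι : Type*} [Fintype ι] (t : ι → ℝ) {c : ℝ} (hc : 0 ≤ c) :
    ((Finset.univ.filter fun m =>
      ((Finset.univ.filter fun m' => t m ≤ t m').card : ℝ) ≤ c).card : ℝ) ≤ c := by
  set S := Finset.univ.filter fun m => ((Finset.univ.filter fun m' => t m ≤ t m').card : ℝ) ≤ c
  obtain hS | hS := S.eq_empty_or_nonempty
  · simpa [hS] using hc
  · obtain ⟨m, hm, hmin⟩ := S.exists_min_image t hS
    refine le_trans ?_ (Finset.mem_filter.1 hm).2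
    exact_mod_cast Finset.card_le_card fun m' hm' =>
      Finset.mem_filter.2 ⟨Finset.mem_univ _, hmin m' hm'⟩

theorem measure_card_filter_le_of_exchangeable {E : Type*} [MeasurableSpace E] {M : ℕ}
    (Q : Measure (Fin (M + 1) → E)) (hQ1 : Q Set.univ ≤ 1)
    (hQ : ∀ σ : Equiv.Perm (Fin (M + 1)), Q.map (fun v m => v (σ m)) = Q)
    {T : E → ℝ} (hT : Measurable T) {α : ℝ} (hα : 0 ≤ α) :
    Q {v | ((Finset.univ.filter fun m => T (v 0) ≤ T (v m)).card : ℝ) ≤ α * (M + 1)}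
      ≤ ENNReal.ofReal α := by
  let B (k : Fin (M + 1)) : Set (Fin (M + 1) → E) :=
    {v | ((Finset.univ.filter fun m => T (v k) ≤ T (v m)).card : ℝ) ≤ α * (M + 1)}
  have hB (k) : MeasurableSet (B k) := by
    refine measurableSet_le ?_ measurable_const
    simp only [Finset.card_filter, Nat.cast_sum]
    refine Finset.measurable_sum _ fun m _ => ?_
    refine (measurable_from_nat (f := fun k : ℕ => (k : ℝ))).comp ?_
    exact Measurable.ite (measurableSet_le (by fun_prop) (by fun_prop)) measurable_const
      measurable_const
  have hB0 (k) : Q (B k) = Q (B 0) := by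
    conv_rhs => rw [← hQ (Equiv.swap 0 k)]
    rw [Measure.map_apply (by fun_prop) (hB 0)]
    congr 1
    ext v
    simp only [B, Set.mem_preimage, Set.mem_ofPred_eq, Equiv.swap_apply_left, Finset.card_filter]
    rw [Equiv.sum_comp (Equiv.swap 0 k) fun m => if T (v k) ≤ T (v m) then 1 else 0]
  have hsum : ((M + 1 : ℕ) : ℝ≥0∞) * Q (B 0) ≤ ((M + 1 : ℕ) : ℝ≥0∞) * ENNReal.ofReal α := by
    calc ((M + 1 : ℕ) : ℝ≥0∞) * Q (B 0) = ∑ k, Q (B k) := by simp [hB0]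
      _ = ∫⁻ v, ∑ k, (B k).indicator 1 v ∂Q := by
        rw [lintegral_finsetSum _ fun k _ => measurable_one.indicator (hB k)]
        simp_rw [lintegral_indicator_one (hB _)]
      _ ≤ ∫⁻ _, ENNReal.ofReal (α * (M + 1)) ∂Q := by
        refine lintegral_mono fun v => ?_
        have h := card_filter_card_filter_le (fun m => T (v m))
          (by positivity : 0 ≤ α * ((M : ℝ) + 1))
        refine le_trans (le_of_eq ?_) (ENNReal.ofReal_le_ofReal h)
        rw [ENNReal.ofReal_natCast, Finset.card_filter, Nat.cast_sum]
        refine Finset.sum_congr rfl fun k _ => ?_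
        simp [B, Set.indicator_apply]
      _ ≤ ENNReal.ofReal (α * (M + 1)) := by
        rw [lintegral_const]
        exact mul_le_of_le_one_right' hQ1
      _ = ((M + 1 : ℕ) : ℝ≥0∞) * ENNReal.ofReal α := by
        rw [mul_comm, ENNReal.ofReal_mul (by positivity), ← ENNReal.ofReal_natCast (M + 1)]
        simp
  exact (ENNReal.mul_le_mul_iff_right (by simp) (ENNReal.natCast_ne_top _)).1 hsum

/-- **Exactness of the conditional permutation test (Theorem 1).**
Data model (this encodes `H₀ : X ⊥ Y | Z` together with `X | Z = z` having density
`q(·|z)` w.r.t. `ν₀`): a single data point is drawn as `Z ~ μZ` and then, conditionally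
independently given `Z`, `X ~ ν₀.withDensity q(·|Z)` and `Y ~ κY Z`; the `n` data points are
i.i.d. Conditionally on the data `d`, the permutations `π⁽¹⁾,…,π⁽ᴹ⁾` are i.i.d. from the CPT
distribution `P(π⁽ᵐ⁾ = π | data) ∝ Π_i q(X_{π(i)}|Z_i)`, and `X⁽ᵐ⁾ = X_{π⁽ᵐ⁾}`. Then the
`M+1` triples `(X,Y,Z), (X⁽¹⁾,Y,Z), …, (X⁽ᴹ⁾,Y,Z)` are exchangeable, and consequently for
every measurable statistic `T` the p-value
`p = (1 + Σ_m 1{T(X⁽ᵐ⁾,Y,Z) ≥ T(X,Y,Z)})/(1+M)` satisfies `P(p ≤ α) ≤ α` for `α ∈ [0,1]`. -/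
theorem cpt_exact {𝒳 𝒴 𝒵 : Type*} [MeasurableSpace 𝒳] [MeasurableSpace 𝒴] [MeasurableSpace 𝒵]
    (ν₀ : Measure 𝒳) [SigmaFinite ν₀]
    (μZ : Measure 𝒵) [IsProbabilityMeasure μZ]
    (κY : 𝒵 → Measure 𝒴) (hκYprob : ∀ zv, IsProbabilityMeasure (κY zv))
    (hκYmeas : Measurable κY)
    (q : 𝒳 → 𝒵 → ℝ≥0) (hqmeas : Measurable fun p : 𝒳 × 𝒵 => q p.1 p.2)
    (hq1 : ∀ zv, ∫⁻ x, (q x zv : ℝ≥0∞) ∂ν₀ = 1)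
    (n M : ℕ)
    (singleLaw : Measure (𝒵 × 𝒳 × 𝒴))
    (hsingle : singleLaw = μZ.bind fun zv =>
      (((ν₀.withDensity fun x => (q x zv : ℝ≥0∞)).prod (κY zv)).map fun xy => (zv, xy.1, xy.2)))
    (dataLaw : Measure (Fin n → 𝒵 × 𝒳 × 𝒴))
    (hdata : dataLaw = Measure.pi fun _ : Fin n => singleLaw)
    (hpos : ∀ᵐ d ∂dataLaw, 0 < ∑ π' : Equiv.Perm (Fin n), cptWeight n q d π')
    (P : Measure ((Fin n → 𝒵 × 𝒳 × 𝒴) × (Fin M → Equiv.Perm (Fin n))))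
    (hP : P = dataLaw.bind fun d =>
      (Measure.pi fun _ : Fin M => cptPermMeasure n q d).map fun πs => (d, πs)) :
    (∀ σ : Equiv.Perm (Fin (M + 1)),
        P.map (fun ω => fun m : Fin (M + 1) =>
            ((fun i => (ω.1 ((Fin.cons (Equiv.refl (Fin n)) ω.2 : Fin (M + 1) → Equiv.Perm (Fin n)) (σ m) i)).2.1,
              fun i => (ω.1 i).2.2, fun i => (ω.1 i).1) :
              (Fin n → 𝒳) × (Fin n → 𝒴) × (Fin n → 𝒵)))
          = P.map (fun ω => fun m : Fin (M + 1) =>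
            ((fun i => (ω.1 ((Fin.cons (Equiv.refl (Fin n)) ω.2 : Fin (M + 1) → Equiv.Perm (Fin n)) m i)).2.1,
              fun i => (ω.1 i).2.2, fun i => (ω.1 i).1) :
              (Fin n → 𝒳) × (Fin n → 𝒴) × (Fin n → 𝒵))))
    ∧
    ∀ T : (Fin n → 𝒳) × (Fin n → 𝒴) × (Fin n → 𝒵) → ℝ, Measurable T →
      ∀ α ∈ Set.Icc (0 : ℝ) 1,
        P {ω | (1 + ((Finset.univ.filter fun m : Fin M =>
              T (fun i => (ω.1 i).2.1, fun i => (ω.1 i).2.2, fun i => (ω.1 i).1)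
                ≤ T (fun i => (ω.1 (ω.2 m i)).2.1, fun i => (ω.1 i).2.2, fun i => (ω.1 i).1)).card) : ℝ)
            / (1 + M) ≤ α}
          ≤ ENNReal.ofReal α := by
  let κ : Kernel 𝒵 𝒴 := ⟨κY, hκYmeas⟩
  have : IsMarkovKernel κ := ⟨hκYprob⟩
  obtain ⟨hdens, hprob⟩ := bind_eq_withDensity ν₀ μZ κ q hqmeas hq1
  have hsκ : singleLaw = μZ.bind fun zv =>
      (((ν₀.withDensity fun x => (q x zv : ℝ≥0∞)).prod (κ zv)).map
        fun xy => (zv, xy.1, xy.2)) := hsingle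
  rw [← hsκ] at hdens hprob
  have : IsProbabilityMeasure dataLaw := by rw [hdata]; infer_instance
  have hP1 : P Set.univ ≤ 1 := hP ▸ bind_cptPermMeasure_univ_le_one M hqmeas dataLaw
  rw [hdata, hdens, pi_eq_map_assemble ν₀ (μZ ⊗ₘ κ) n q hqmeas] at hP
  have hex := map_permTriples_comp_perm ν₀ (Measure.pi fun _ : Fin n => μZ ⊗ₘ κ) hqmeas hP
  refine ⟨hex, fun T hT α hα => ?_⟩
  have hV := measurable_permTriples (𝒳 := 𝒳) (𝒴 := 𝒴) (𝒵 := 𝒵) (n := n) (M := M)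
  have hrank := measure_card_filter_le_of_exchangeable (P.map permTriples)
    (by rwa [Measure.map_apply hV .univ, Set.preimage_univ])
    (fun σ => by rw [Measure.map_map (by fun_prop) hV]; exact hex σ) hT hα.1
  refine le_trans ?_ ((Measure.le_map_apply hV.aemeasurable _).trans hrank)
  refine measure_mono fun ω hω => ?_
  rw [Set.mem_ofPred_eq, div_le_iff₀ (by positivity)] at hω
  rw [Set.mem_preimage, Set.mem_ofPred_eq, Finset.card_filter, Fin.sum_univ_succ,
    if_pos le_rfl, ← Finset.card_filter]
  push_cast
  rw [add_comm (M : ℝ) 1]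
  exact hω
end

section
/- Let x_1,…,x_n ∈ 𝒳, z_1,…,z_n ∈ 𝒵, and let q : 𝒳 × 𝒵 → [0,∞), h : 𝒳 → (0,∞), c : 𝒵 → (0,∞) be functions, and define q₁(x, z) = q(x, z)·h(x)·c(z). For π ∈ S_n, let w(π) = Π_{i=1}^n q(x_{π(i)}, z_i) and w₁(π) = Π_{i=1}^n q₁(x_{π(i)}, z_i). If Σ_{π' ∈ S_n} w(π') > 0, then Σ_{π' ∈ S_n} w₁(π') > 0 and for every π ∈ S_n, w₁(π) / Σ_{π' ∈ S_n} w₁(π') = w(π) / Σ_{π' ∈ S_n} w(π'). In particular, the CPT permutation distribution is invariant under replacing q by q₁, i.e., the CPT is invariant to changes of base measure. -/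
/-- **Invariance of the CPT permutation distribution to changes of base measure.**
If `q₁(x,z) = q(x,z)·h(x)·c(z)` with `h > 0` and `c > 0`, then the CPT permutation
distribution `π ↦ w(π)/Σ_{π'} w(π')`, where `w(π) = Π_i q(x_{π i}, z_i)`, is unchanged
when `q` is replaced by `q₁`. -/
theorem cpt_base_measure_invariance {X Z : Type*} (n : ℕ) (x : Fin n → X) (z : Fin n → Z)
    (q : X → Z → ℝ) (h : X → ℝ) (c : Z → ℝ)
    (hq : ∀ a b, 0 ≤ q a b) (hh : ∀ a, 0 < h a) (hc : ∀ b, 0 < c b)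
    (q₁ : X → Z → ℝ) (hq₁ : ∀ a b, q₁ a b = q a b * h a * c b)
    (w w₁ : Equiv.Perm (Fin n) → ℝ)
    (hw : ∀ π, w π = ∏ i, q (x (π i)) (z i))
    (hw₁ : ∀ π, w₁ π = ∏ i, q₁ (x (π i)) (z i))
    (hpos : 0 < ∑ π' : Equiv.Perm (Fin n), w π') :
    0 < (∑ π' : Equiv.Perm (Fin n), w₁ π') ∧
      ∀ π : Equiv.Perm (Fin n),
        w₁ π / (∑ π' : Equiv.Perm (Fin n), w₁ π')
          = w π / (∑ π' : Equiv.Perm (Fin n), w π') := by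
  have hK : 0 < (∏ i, h (x i)) * ∏ i, c (z i) :=
    mul_pos (Finset.prod_pos fun i _ => hh _) (Finset.prod_pos fun i _ => hc _)
  have hscale : ∀ π, w₁ π = w π * ((∏ i, h (x i)) * ∏ i, c (z i)) := fun π => by
    rw [hw₁, hw, ← Equiv.prod_comp π fun i => h (x i)]
    simp only [hq₁, Finset.prod_mul_distrib, mul_assoc]
  simp only [hscale, ← Finset.sum_mul]
  exact ⟨mul_pos hpos hK, fun π => mul_div_mul_right _ _ hK.ne'⟩
end

section
/- Let n ≥ 2 and let w : S_n → (0,∞) be a strictly positive weight function. Let 𝒫 be the set of partitions of {1,…,n} into ⌊n/2⌋ disjoint pairs (with one index left unpaired if n is odd), and for p ∈ 𝒫 write π ~_p π' if π' = π ∘ σ where σ is a product of the transpositions of some subset of the pairs in p. Define the transition kernel K(π, π') = (1/|𝒫|) Σ_{p ∈ 𝒫} 1{π' ~_p π} · w(π') / (Σ_{π'' : π'' ~_p π} w(π'')). Then the distribution μ(π) = w(π)/Σ_{π'} w(π') is the unique stationary distribution of K: any probability distribution μ' on S_n satisfying Σ_{π} μ'(π)·K(π, π') = μ'(π') for all π'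 must equal μ. -/
open scoped Classical

/-- A partition of `{1,…,n}` into `⌊n/2⌋` disjoint pairs (with one index left unpaired when
`n` is odd), encoded as an involutive permutation whose number of fixed points is `n % 2`. -/
def IsPairing {n : ℕ} (σ : Equiv.Perm (Fin n)) : Prop :=
  σ * σ = 1 ∧ (Finset.univ.filter fun i => σ i = i).card = n % 2

/-- The set `𝒫` of all partitions of `{1,…,n}` into `⌊n/2⌋` disjoint pairs. -/
noncomputable def pairings (n : ℕ) : Finset (Equiv.Perm (Fin n)) :=
  Finset.univ.filter IsPairing

/-- `swapRel p π π'` : `π'` is obtained from `π` by composing on the right with the product of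
the transpositions of a subset of the pairs of the pairing `p` (i.e. `π' = π ∘ σ` where `σ`
fixes each index or swaps it with its partner under `p`). -/
def swapRel {n : ℕ} (p : Equiv.Perm (Fin n)) (π π' : Equiv.Perm (Fin n)) : Prop :=
  ∃ τ : Equiv.Perm (Fin n), (∀ i, τ i = i ∨ τ i = p i) ∧ π' = π * τ

/-- The one-step transition kernel of the parallelized pairwise sampler (Algorithm 1):
`K(π,π') = (1/|𝒫|) Σ_{p ∈ 𝒫} 1{π' ~_p π} · w(π') / Σ_{π'' ~_p π} w(π'')`. -/
noncomputable def pairwiseKernel {n : ℕ} (w : Equiv.Perm (Fin n) → ℝ)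
    (π π' : Equiv.Perm (Fin n)) : ℝ :=
  (1 / ((pairings n).card : ℝ)) * ∑ p ∈ pairings n,
    if swapRel p π π' then
      w π' / ∑ π'' ∈ Finset.univ.filter fun π'' => swapRel p π π'', w π''
    else 0


theorem isPairing_revPerm (n : ℕ) : IsPairing (Fin.revPerm : Equiv.Perm (Fin n)) := by
  refine ⟨by ext i; simp, ?_⟩
  rcases Nat.even_or_odd' n with ⟨k, rfl | rfl⟩
  · rw [Nat.mul_mod_right, Finset.card_eq_zero, Finset.filter_eq_empty_iff]
    intro i _ h
    have h1 := congrArg Fin.val h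
    rw [Fin.revPerm_apply, Fin.val_rev] at h1
    lia
  · have h2 : (2 * k + 1) % 2 = 1 := by lia
    rw [h2, Finset.card_eq_one]
    refine ⟨⟨k, by lia⟩, ?_⟩
    ext i
    simp only [Finset.mem_filter, Finset.mem_univ, true_and, Finset.mem_singleton,
      Fin.ext_iff, Fin.revPerm_apply, Fin.val_rev]
    lia

theorem IsPairing.conj {n : ℕ} {p : Equiv.Perm (Fin n)} (hp : IsPairing p)
    (σ : Equiv.Perm (Fin n)) : IsPairing (σ * p * σ⁻¹) := by
  refine ⟨?_, ?_⟩
  · have h : σ * p * σ⁻¹ * (σ * p * σ⁻¹) = σ * (p * p) * σ⁻¹ := by group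
    rw [h, hp.1, mul_one, mul_inv_cancel]
  · rw [← hp.2]
    refine (Finset.card_bij (fun i _ => σ i) ?_ ?_ ?_).symm
    · intro i hi
      rw [Finset.mem_filter] at hi ⊢
      exact ⟨Finset.mem_univ _, by simpa using hi.2⟩
    · intro i _ j _ h
      exact σ.injective h
    · intro j hj
      refine ⟨σ⁻¹ j, ?_, by simp⟩
      rw [Finset.mem_filter] at hj ⊢
      refine ⟨Finset.mem_univ _, σ.injective ?_⟩
      simpa using hj.2

/-- Any two distinct indices are paired by some pairing. -/
theorem exists_isPairing_apply_eq {n : ℕ} {i j : Fin n} (hij : i ≠ j) :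
    ∃ p : Equiv.Perm (Fin n), IsPairing p ∧ p i = j := by
  obtain ⟨m, rfl⟩ : ∃ m, n = m + 1 := ⟨n - 1, by have := i.2; lia⟩
  have h0 : (0 : Fin (m + 1)) ≠ Fin.last m := by
    intro h
    have h1 := congrArg Fin.val h
    simp only [Fin.val_zero, Fin.val_last] at h1
    have := i.2
    have := j.2
    exact hij (Fin.ext (by lia))
  let σ : Equiv.Perm (Fin (m + 1)) :=
    Equiv.swap (Equiv.swap 0 i (Fin.last m)) j * Equiv.swap 0 i
  have hσ0 : σ 0 = i := by
    have h2 : i ≠ Equiv.swap 0 i (Fin.last m) := by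
      intro h
      apply h0
      apply (Equiv.swap 0 i).injective
      rw [← h, Equiv.swap_apply_left]
    simp only [σ, Equiv.Perm.mul_apply, Equiv.swap_apply_left]
    exact Equiv.swap_apply_of_ne_of_ne h2 hij
  have hσl : σ (Fin.last m) = j := by
    simp only [σ, Equiv.Perm.mul_apply, Equiv.swap_apply_left]
  refine ⟨_, (isPairing_revPerm (m + 1)).conj σ, ?_⟩
  have h3 : σ⁻¹ i = 0 := by rw [← hσ0]; simp
  rw [Equiv.Perm.mul_apply, Equiv.Perm.mul_apply, h3, Fin.revPerm_apply, Fin.rev_zero, hσl]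

theorem swapRel_refl {n : ℕ} (p π : Equiv.Perm (Fin n)) : swapRel p π π :=
  ⟨1, fun _ => Or.inl rfl, (mul_one π).symm⟩

theorem IsPairing.apply_apply {n : ℕ} {p : Equiv.Perm (Fin n)} (hp : IsPairing p) (i : Fin n) :
    p (p i) = i := by
  rw [← Equiv.Perm.mul_apply, hp.1, Equiv.Perm.one_apply]

theorem IsPairing.swapRel_symm {n : ℕ} {p π π' : Equiv.Perm (Fin n)} (hp : IsPairing p)
    (h : swapRel p π π') : swapRel p π' π := by
  obtain ⟨τ, hτ, rfl⟩ := h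
  refine ⟨τ⁻¹, fun i => ?_, by group⟩
  have h1 : τ (τ⁻¹ i) = i := by simp
  rcases hτ (τ⁻¹ i) with h | h
  · exact Or.inl (h.symm.trans h1)
  · right
    rw [h1] at h
    conv_rhs => rw [h]
    rw [hp.apply_apply]

theorem IsPairing.swapRel_trans {n : ℕ} {p π π' π'' : Equiv.Perm (Fin n)} (hp : IsPairing p)
    (h : swapRel p π π') (h' : swapRel p π' π'') : swapRel p π π'' := by
  obtain ⟨τ, hτ, rfl⟩ := h
  obtain ⟨τ', hτ', rfl⟩ := h'
  refine ⟨τ * τ', fun i => ?_, by group⟩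
  rw [Equiv.Perm.mul_apply]
  rcases hτ' i with h | h <;> rw [h]
  · exact hτ i
  · rcases hτ (p i) with h1 | h1 <;> rw [h1]
    · exact Or.inr rfl
    · exact Or.inl (hp.apply_apply i)

theorem IsPairing.filter_swapRel_eq {n : ℕ} {p π π' : Equiv.Perm (Fin n)} (hp : IsPairing p)
    (h : swapRel p π π') :
    (Finset.univ.filter fun ρ => swapRel p π ρ) = Finset.univ.filter fun ρ => swapRel p π' ρ :=
  Finset.filter_congr fun _ _ =>
    ⟨hp.swapRel_trans (hp.swapRel_symm h), hp.swapRel_trans h⟩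

theorem mem_pairings {n : ℕ} {p : Equiv.Perm (Fin n)} : p ∈ pairings n ↔ IsPairing p := by
  simp [pairings]

theorem card_pairings_pos (n : ℕ) : 0 < ((pairings n).card : ℝ) :=
  Nat.cast_pos.2 (Finset.card_pos.2 ⟨_, mem_pairings.2 (isPairing_revPerm n)⟩)

section Kernel

variable {n : ℕ} {w : Equiv.Perm (Fin n) → ℝ}

theorem sum_swapRel_pos (hw : ∀ π, 0 < w π) (p π : Equiv.Perm (Fin n)) :
    0 < ∑ ρ ∈ Finset.univ.filter fun ρ => swapRel p π ρ, w ρ :=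
  Finset.sum_pos (fun _ _ => hw _) ⟨π, by simp [swapRel_refl]⟩

/-- Detailed balance of the pairwise kernel with respect to its weight. -/
theorem pairwiseKernel_detailed_balance (w : Equiv.Perm (Fin n) → ℝ)
    (π π' : Equiv.Perm (Fin n)) :
    w π * pairwiseKernel w π π' = w π' * pairwiseKernel w π' π := by
  unfold pairwiseKernel
  rw [mul_left_comm, mul_left_comm (w π'), Finset.mul_sum _ _ (w π), Finset.mul_sum _ _ (w π')]
  refine congrArg _ (Finset.sum_congr rfl fun p hp => ?_)
  have hp := mem_pairings.1 hp
  by_cases h : swapRel p π π'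
  · rw [if_pos h, if_pos (hp.swapRel_symm h), hp.filter_swapRel_eq h]
    ring
  · rw [if_neg h, if_neg fun h' => h (hp.swapRel_symm h'), mul_zero, mul_zero]

theorem sum_pairwiseKernel (hw : ∀ π, 0 < w π) (π : Equiv.Perm (Fin n)) :
    ∑ π', pairwiseKernel w π π' = 1 := by
  unfold pairwiseKernel
  rw [← Finset.mul_sum, Finset.sum_comm]
  have h : ∀ p ∈ pairings n, (∑ π' : Equiv.Perm (Fin n), if swapRel p π π' then
      w π' / ∑ ρ ∈ Finset.univ.filter fun ρ => swapRel p π ρ, w ρ else 0) = 1 := by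
    intro p _
    rw [← Finset.sum_filter, ← Finset.sum_div]
    exact div_self (sum_swapRel_pos hw p π).ne'
  rw [Finset.sum_congr rfl h, Finset.sum_const, nsmul_eq_mul, mul_one]
  exact one_div_mul_cancel (card_pairings_pos n).ne'

theorem pairwiseKernel_summand_nonneg (hw : ∀ π, 0 < w π) (p π π' : Equiv.Perm (Fin n)) :
    0 ≤ if swapRel p π π' then
      w π' / ∑ ρ ∈ Finset.univ.filter fun ρ => swapRel p π ρ, w ρ else 0 := by
  split_ifs
  · exact (div_pos (hw _) (sum_swapRel_pos hw p π)).le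
  · exact le_rfl

theorem pairwiseKernel_nonneg (hw : ∀ π, 0 < w π) (π π' : Equiv.Perm (Fin n)) :
    0 ≤ pairwiseKernel w π π' :=
  mul_nonneg (one_div_pos.2 (card_pairings_pos n)).le
    (Finset.sum_nonneg fun p _ => pairwiseKernel_summand_nonneg hw p π π')

theorem pairwiseKernel_mul_swap_pos (hw : ∀ π, 0 < w π) (π : Equiv.Perm (Fin n))
    {i j : Fin n} (hij : i ≠ j) : 0 < pairwiseKernel w π (π * Equiv.swap i j) := by
  obtain ⟨p, hp, hpij⟩ := exists_isPairing_apply_eq hij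
  have hrel : swapRel p π (π * Equiv.swap i j) := by
    refine ⟨_, fun k => ?_, rfl⟩
    by_cases hi : k = i
    · right
      rw [hi, Equiv.swap_apply_left, hpij]
    by_cases hj : k = j
    · right
      rw [hj, Equiv.swap_apply_right, ← hpij, hp.apply_apply]
    · exact Or.inl (Equiv.swap_apply_of_ne_of_ne hi hj)
  refine mul_pos (one_div_pos.2 (card_pairings_pos n)) (Finset.sum_pos'
    (fun q _ => pairwiseKernel_summand_nonneg hw q π _) ⟨p, mem_pairings.2 hp, ?_⟩)
  rw [if_pos hrel]
  exact div_pos (hw _) (sum_swapRel_pos hw p π)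

/-- Maximum principle: harmonic functions of the pairwise kernel are constant. -/
theorem exists_eq_const_of_harmonic (hw : ∀ π, 0 < w π) {f : Equiv.Perm (Fin n) → ℝ}
    (hf : ∀ π, ∑ π', pairwiseKernel w π π' * f π' = f π) : ∃ c, ∀ π, f π = c := by
  obtain ⟨π₀, hmax⟩ := Finite.exists_max f
  have step : ∀ π, f π = f π₀ → ∀ i j, i ≠ j → f (π * Equiv.swap i j) = f π₀ := by
    intro π hπ i j hij
    have hsum : ∑ π', pairwiseKernel w π π' * (f π₀ - f π') = 0 := by
      simp only [mul_sub]
      rw [Finset.sum_sub_distrib, ← Finset.sum_mul, sum_pairwiseKernel hw, hf, hπ, one_mul,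
        sub_self]
    have hzero := (Finset.sum_eq_zero_iff_of_nonneg fun π' _ =>
      mul_nonneg (pairwiseKernel_nonneg hw π π') (sub_nonneg.2 (hmax π'))).1 hsum
        (π * Equiv.swap i j) (Finset.mem_univ _)
    rcases mul_eq_zero.1 hzero with h | h
    · exact absurd h (pairwiseKernel_mul_swap_pos hw π hij).ne'
    · linarith
  have key : ∀ σ : Equiv.Perm (Fin n), f (π₀ * σ) = f π₀ := by
    intro σ
    induction σ using Equiv.Perm.swap_induction_on' with
    | one => rw [mul_one]
    | mul_swap σ i j hij ih => rw [← mul_assoc]; exact step _ ih i j hij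
  exact ⟨f π₀, fun π => by simpa using key (π₀⁻¹ * π)⟩

end Kernel

/-- **Uniqueness of the stationary distribution of the parallelized pairwise sampler.**
For any strictly positive weight function `w` on `S_n` (`n ≥ 2`), any probability
distribution `μ'` on `S_n` that is stationary for the kernel `K` of Algorithm 1 must equal
`μ(π) = w(π)/Σ_{π'} w(π')`. -/
theorem pairwiseKernel_stationary_unique {n : ℕ} (hn : 2 ≤ n)
    (w : Equiv.Perm (Fin n) → ℝ) (hw : ∀ π, 0 < w π)
    (μ : Equiv.Perm (Fin n) → ℝ)
    (hμ : ∀ π, μ π = w π / ∑ π' : Equiv.Perm (Fin n), w π')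
    (μ' : Equiv.Perm (Fin n) → ℝ) (hμ'0 : ∀ π, 0 ≤ μ' π)
    (hμ'1 : ∑ π : Equiv.Perm (Fin n), μ' π = 1)
    (hstat : ∀ π' : Equiv.Perm (Fin n),
      ∑ π : Equiv.Perm (Fin n), μ' π * pairwiseKernel w π π' = μ' π') :
    μ' = μ := by
  have hharm : ∀ π, ∑ π', pairwiseKernel w π π' * (μ' π' / w π') = μ' π / w π := by
    intro π
    rw [eq_div_iff (hw π).ne', ← hstat π, Finset.sum_mul]
    refine Finset.sum_congr rfl fun π' _ => ?_
    have hb := pairwiseKernel_detailed_balance w π π'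
    have hne := (hw π').ne'
    calc pairwiseKernel w π π' * (μ' π' / w π') * w π
        = w π * pairwiseKernel w π π' * (μ' π' / w π') := by ring
      _ = μ' π' * pairwiseKernel w π' π := by rw [hb]; field_simp
  obtain ⟨c, hc⟩ := exists_eq_const_of_harmonic hw hharm
  have hμ'c : ∀ π, μ' π = c * w π := fun π => (div_eq_iff (hw π).ne').1 (hc π)
  have hsum : c * ∑ π, w π = 1 := by
    rw [← hμ'1, Finset.mul_sum]
    exact Finset.sum_congr rfl fun π _ => (hμ'c π).symm
  have hpos : 0 < ∑ π, w π := Finset.sum_pos (fun π _ => hw π) Finset.univ_nonempty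
  funext π
  rw [hμ, hμ'c, eq_div_iff hpos.ne', mul_right_comm, hsum, one_mul]
end

section
/- Let 𝒮 be a finite nonempty set, μ a probability distribution on 𝒮, and K : 𝒮 × 𝒮 → [0,1] a Markov transition kernel (Σ_{b} K(a,b) = 1 for all a) that is reversible with respect to μ, i.e., μ(a)·K(a,b) = μ(b)·K(b,a) for all a, b ∈ 𝒮. Fix integers S ≥ 1 and M ≥ 1. Let Π be a random element of 𝒮 with distribution μ; conditional on Π, let Π_♯ have distribution K^S(Π, ·) (the S-step transition probabilities from Π); and conditional on (Π, Π_♯), let Π^(1), …, Π^(M) be i.i.d. with distribution K^S(Π_♯, ·). Then the sequence (Π, Π^(1), …, Π^(M)) is exchangeable: its joint distribution is invariant under every permutation of the M+1 coordinates. -/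
/-- `S`-step transition probabilities of a Markov kernel `K` on a finite state space
(the `S`-th matrix power of `K`). -/
def kernelPow {S : Type*} [Fintype S] [DecidableEq S] (K : S → S → ℝ) : ℕ → S → S → ℝ
  | 0, a, b => if a = b then 1 else 0
  | (s + 1), a, b => ∑ c, K a c * kernelPow K s c b

theorem kernelPow_eq_matrix_pow {S : Type*} [Fintype S] [DecidableEq S] (K : S → S → ℝ)
    (s : ℕ) (a b : S) : kernelPow K s a b = (Matrix.of K ^ s) a b := by
  induction s generalizing a with
  | zero => simp [kernelPow, Matrix.one_apply]
  | succ s ih => simp [kernelPow, pow_succ', Matrix.mul_apply, ih]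

/-- Detailed balance passes from a kernel to its iterates. -/
theorem kernelPow_reversible {S : Type*} [Fintype S] [DecidableEq S] {μ : S → ℝ}
    {K : S → S → ℝ} (hrev : ∀ a b, μ a * K a b = μ b * K b a) (s : ℕ) (a b : S) :
    μ a * kernelPow K s a b = μ b * kernelPow K s b a := by
  have h : SemiconjBy (Matrix.diagonal μ) (Matrix.of K) (Matrix.of K).transpose := by
    ext a b
    simp [Matrix.diagonal_mul, Matrix.mul_diagonal, hrev a b, mul_comm]
  have hs := congrFun (congrFun (h.pow_right s).eq a) b
  rw [← Matrix.transpose_pow, Matrix.diagonal_mul, Matrix.mul_diagonal,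
    Matrix.transpose_apply] at hs
  rw [kernelPow_eq_matrix_pow, kernelPow_eq_matrix_pow, hs, mul_comm]

/-- **Exchangeability of the exchangeable sampler (Algorithm 2).**
Let `K` be a Markov kernel on a finite nonempty state space `𝒮`, reversible with respect to a
probability distribution `μ`. Draw `Π ~ μ`, then `Π♯ ~ K^S(Π,·)`, then, conditionally
i.i.d. given `Π♯`, draw `Π⁽¹⁾,…,Π⁽ᴹ⁾ ~ K^S(Π♯,·)`. Then the joint distribution `J` of the
sequence `(Π, Π⁽¹⁾, …, Π⁽ᴹ⁾)` is invariant under every permutation of its `M + 1`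
coordinates, i.e. the sequence is exchangeable. -/
theorem exchangeable_sampler {𝒮 : Type*} [Fintype 𝒮] [DecidableEq 𝒮] [Nonempty 𝒮]
    (μ : 𝒮 → ℝ) (hμ0 : ∀ a, 0 ≤ μ a) (hμ1 : ∑ a, μ a = 1)
    (K : 𝒮 → 𝒮 → ℝ) (hK0 : ∀ a b, 0 ≤ K a b) (hK1 : ∀ a, ∑ b, K a b = 1)
    (hrev : ∀ a b, μ a * K a b = μ b * K b a)
    (S M : ℕ) (hS : 1 ≤ S) (hM : 1 ≤ M)
    (J : (Fin (M + 1) → 𝒮) → ℝ)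
    (hJ : ∀ v, J v = ∑ c, μ (v 0) * kernelPow K S (v 0) c
      * ∏ m : Fin M, kernelPow K S c (v m.succ)) :
    ∀ σ : Equiv.Perm (Fin (M + 1)), ∀ v, J (v ∘ σ) = J v := by
  have hJ_symm : ∀ v, J v = ∑ c, μ c * ∏ i, kernelPow K S c (v i) := fun v => by
    simp only [hJ, Fin.prod_univ_succ, kernelPow_reversible hrev S (v 0), mul_assoc]
  intro σ v
  rw [hJ_symm, hJ_symm]
  exact Finset.sum_congr rfl fun c _ =>
    congrArg (μ c * ·) (Equiv.prod_comp σ fun i => kernelPow K S c (v i))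
end

section
/- Let μ and ν be probability measures on a measurable space 𝒲, let M ≥ 1 be an integer, let T : 𝒲 → ℝ be measurable, and let α ∈ [0,1]. Let W ~ μ and, independently of W, let W^(1), …, W^(M) be i.i.d. with distribution ν. Define the p-value p = (1 + Σ_{m=1}^M 1{T(W^(m)) ≥ T(W)}) / (1 + M). Then P(p ≤ α) ≤ α + d_TV(μ, ν). (Applied with 𝒲 = 𝒳ⁿ, μ the true conditional law Q⋆ⁿ(·|Z) of X given (Y, Z) under the null, and ν the approximate product law Qⁿ(·|Z) used for resampling, this bounds the conditional Type I error of the conditional randomization test by α + d_TV(Q⋆ⁿ(·|Z), Qⁿ(·|Z)).) -/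
open MeasureTheory

/-- Total variation distance between two measures: `sup_A |μ(A) − ν(A)|` over measurable `A`. -/
noncomputable def tvDist {W : Type*} [MeasurableSpace W] (μ ν : Measure W) : ℝ :=
  ⨆ A : {A : Set W // MeasurableSet A}, |(μ A).toReal - (ν A).toReal|

open Finset in
/-- At most `c` indices have upper rank at most `c`. -/
theorem card_filter_card_le_le {ι : Type*} [Fintype ι] (t : ι → ℝ) (c : ℝ) (hc : 0 ≤ c) :
    ((univ.filter fun i => ((univ.filter fun j => t i ≤ t j).card : ℝ) ≤ c).card : ℝ) ≤ c := by
  rcases (univ.filter fun i => ((univ.filter fun j => t i ≤ t j).card : ℝ) ≤ c).eq_empty_or_nonempty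
    with h | h
  · simpa [h] using hc
  · obtain ⟨i, hi, hmin⟩ := exists_min_image _ t h
    refine le_trans ?_ (mem_filter.1 hi).2
    exact_mod_cast card_le_card fun j hj => mem_filter.2 ⟨mem_univ j, hmin j hj⟩

theorem measurable_card_filter_le {Ω ι : Type*} [MeasurableSpace Ω] [Fintype ι]
    {f : Ω → ℝ} {g : ι → Ω → ℝ} (hf : Measurable f) (hg : ∀ i, Measurable (g i)) :
    Measurable fun ω => ((Finset.univ.filter fun i => f ω ≤ g i ω).card : ℝ) := by
  simp only [Finset.card_filter, Nat.cast_sum, Nat.cast_ite, Nat.cast_one, Nat.cast_zero]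
  exact Finset.measurable_sum _ fun i _ =>
    Measurable.ite (measurableSet_le hf (hg i)) measurable_const measurable_const

theorem measure_le_add_tvDist {W : Type*} [MeasurableSpace W] (μ ν : Measure W)
    [IsProbabilityMeasure μ] [IsProbabilityMeasure ν] {A : Set W} (hA : MeasurableSet A) :
    μ A ≤ ν A + ENNReal.ofReal (tvDist μ ν) := by
  have hbdd : BddAbove (Set.range fun A : {A : Set W // MeasurableSet A} =>
      |(μ A).toReal - (ν A).toReal|) := by
    refine ⟨1, ?_⟩
    rintro _ ⟨B, rfl⟩
    have h1 : (μ B).toReal ≤ 1 := measureReal_le_one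
    have h2 : (ν B).toReal ≤ 1 := measureReal_le_one
    have h3 : 0 ≤ (μ B).toReal := ENNReal.toReal_nonneg
    have h4 : 0 ≤ (ν B).toReal := ENNReal.toReal_nonneg
    exact abs_le.2 ⟨by linarith, by linarith⟩
  have h : |(μ A).toReal - (ν A).toReal| ≤ tvDist μ ν := le_ciSup hbdd ⟨A, hA⟩
  have h' := (le_abs_self _).trans h
  rw [← ENNReal.ofReal_toReal (measure_ne_top μ A), ← ENNReal.ofReal_toReal (measure_ne_top ν A),
    ← ENNReal.ofReal_add ENNReal.toReal_nonneg ((abs_nonneg _).trans h)]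
  exact ENNReal.ofReal_le_ofReal (by linarith)

theorem prod_le_prod_add_tvDist {W V : Type*} [MeasurableSpace W] [MeasurableSpace V]
    (μ ν : Measure W) [IsProbabilityMeasure μ] [IsProbabilityMeasure ν]
    (π : Measure V) [IsProbabilityMeasure π] {E : Set (W × V)} (hE : MeasurableSet E) :
    μ.prod π E ≤ ν.prod π E + ENNReal.ofReal (tvDist μ ν) := by
  rw [Measure.prod_apply_symm hE, Measure.prod_apply_symm hE]
  calc ∫⁻ y, μ ((fun x => (x, y)) ⁻¹' E) ∂π
      ≤ ∫⁻ y, (ν ((fun x => (x, y)) ⁻¹' E) + ENNReal.ofReal (tvDist μ ν)) ∂π :=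
        lintegral_mono fun y => measure_le_add_tvDist μ ν (measurable_prodMk_right hE)
    _ = _ := by rw [lintegral_add_right _ measurable_const]; simp

/-- The upper rank of a fixed coordinate of an i.i.d. sample is stochastically at least uniform. -/
theorem pi_card_filter_le_le {W ι : Type*} [MeasurableSpace W] [Fintype ι] (ν : Measure W)
    [IsProbabilityMeasure ν] {T : W → ℝ} (hT : Measurable T) {c : ℝ} (hc : 0 ≤ c) (i₀ : ι) :
    Fintype.card ι * Measure.pi (fun _ : ι => ν)
      {x | ((Finset.univ.filter fun j => T (x i₀) ≤ T (x j)).card : ℝ) ≤ c} ≤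
        ENNReal.ofReal c := by
  classical
  set P := Measure.pi (fun _ : ι => ν)
  let A : ι → Set (ι → W) :=
    fun i => {x | ((Finset.univ.filter fun j => T (x i) ≤ T (x j)).card : ℝ) ≤ c}
  have hA (i : ι) : MeasurableSet (A i) :=
    measurableSet_le (measurable_card_filter_le (by fun_prop) (by fun_prop)) measurable_const
  have hP (i : ι) : P (A i) = P (A i₀) := by
    have h := measurePreserving_piCongrLeft (fun _ : ι => ν) (Equiv.swap i i₀)
    rw [← h.measure_preimage (hA i).nullMeasurableSet]
    congr 1
    ext x
    have hx (j : ι) : MeasurableEquiv.piCongrLeft (fun _ : ι => W) (Equiv.swap i i₀) x j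
        = x (Equiv.swap i i₀ j) := by
      simpa using MeasurableEquiv.piCongrLeft_apply_apply (β := fun _ => W) (Equiv.swap i i₀) x
        (Equiv.swap i i₀ j)
    simp only [A, Set.mem_preimage, Set.mem_ofPred_eq, hx, Equiv.swap_apply_left]
    rw [Finset.card_equiv (Equiv.swap i i₀)]
    simp
  calc Fintype.card ι * P (A i₀) = ∑ i, P (A i) := by simp [hP]
    _ = ∑ i, ∫⁻ x, (A i).indicator 1 x ∂P := by simp [lintegral_indicator_one (hA _)]
    _ = ∫⁻ x, ∑ i, (A i).indicator 1 x ∂P :=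
        (lintegral_finsetSum _ fun i _ => measurable_one.indicator (hA i)).symm
    _ ≤ ∫⁻ _, ENNReal.ofReal c ∂P := by
        refine lintegral_mono fun x => ?_
        have h := card_filter_card_le_le (fun i => T (x i)) c hc
        have h' := ENNReal.ofReal_le_ofReal h
        rw [ENNReal.ofReal_natCast] at h'
        refine le_trans (le_of_eq ?_) h'
        simp [A, Set.indicator_apply]
    _ = ENNReal.ofReal c := by simp

/-- **Robustness of the conditional randomization test (Theorem 3, CRT case).**
Let `W ~ μ` and, independently, `W⁽¹⁾,…,W⁽ᴹ⁾` i.i.d. `~ ν`. Then for any measurable statistic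
`T` and any `α ∈ [0,1]`, the p-value
`p = (1 + #{m : T(W⁽ᵐ⁾) ≥ T(W)})/(1+M)` satisfies `P(p ≤ α) ≤ α + d_TV(μ,ν)`. -/
theorem crt_robust_type_I_error {W : Type*} [MeasurableSpace W] (μ ν : Measure W)
    [IsProbabilityMeasure μ] [IsProbabilityMeasure ν]
    (M : ℕ) (hM : 1 ≤ M) (T : W → ℝ) (hT : Measurable T)
    (α : ℝ) (hα : α ∈ Set.Icc (0 : ℝ) 1) :
    (μ.prod (Measure.pi fun _ : Fin M => ν))
        {ω | (1 + ((Finset.univ.filter fun m : Fin M => T ω.1 ≤ T (ω.2 m)).card) : ℝ) / (1 + M)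
          ≤ α}
      ≤ ENNReal.ofReal (α + tvDist μ ν) := by
  classical
  set E : Set (W × (Fin M → W)) := {ω |
    (1 + ((Finset.univ.filter fun m : Fin M => T ω.1 ≤ T (ω.2 m)).card) : ℝ) / (1 + M) ≤ α} with hEdef
  have hE : MeasurableSet E := measurableSet_le
    ((measurable_const.add (measurable_card_filter_le (by fun_prop) (by fun_prop))).div_const _)
    measurable_const
  have hM0 : (0 : ℝ) < 1 + M := by positivity
  have htv : 0 ≤ tvDist μ ν := Real.iSup_nonneg fun _ => abs_nonneg _
  rw [ENNReal.ofReal_add hα.1 htv]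
  refine (prod_le_prod_add_tvDist μ ν _ hE).trans (add_le_add_left ?_ _)
  have hpres := measurePreserving_piFinSuccAbove (fun _ : Fin (M + 1) => ν) 0
  rw [← hpres.measure_preimage hE.nullMeasurableSet]
  have hc : 0 ≤ α * (1 + M) := mul_nonneg hα.1 hM0.le
  have key := pi_card_filter_le_le ν hT hc (0 : Fin (M + 1))
  have hset : MeasurableEquiv.piFinSuccAbove (fun _ : Fin (M + 1) => W) 0 ⁻¹' E =
      {x | ((Finset.univ.filter fun j => T (x 0) ≤ T (x j)).card : ℝ) ≤ α * (1 + M)} := by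
    ext x
    simp only [hEdef, Set.mem_preimage, Set.mem_ofPred_eq, div_le_iff₀ hM0]
    rw [Fin.card_filter_univ_succ]
    simp [MeasurableEquiv.piFinSuccAbove, add_comm, Fin.tail]
  rw [hset]
  rw [Fintype.card_fin, mul_comm α, ENNReal.ofReal_mul hM0.le] at key
  have hcast : ENNReal.ofReal (1 + M) = ((M + 1 : ℕ) : ENNReal) := by
    rw [← ENNReal.ofReal_natCast]; push_cast; rw [add_comm]
  rw [hcast, mul_comm _ α] at key
  exact (ENNReal.mul_le_mul_iff_right (by simp) (by simp)).1 key
end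

section
/- Let μ and ν be probability measures on a measurable space 𝒲 and let M ≥ 2 be an integer. Let W ~ μ and, independently of W, let W^(1), …, W^(M) be i.i.d. with distribution ν. Then there exists a measurable set A ⊆ 𝒲 such that, taking the statistic T = 1_A and the p-value p = (1 + Σ_{m=1}^M 1{T(W^(m)) ≥ T(W)}) / (1 + M), one has sup_{α ∈ [0,1]} ( P(p ≤ α) − α ) ≥ d_TV(μ, ν) − 2.5·√(log(M)/M). (Applied with μ = Q⋆ⁿ(·|Z) and ν = Qⁿ(·|Z), this shows the worst-case excess conditional Type I error of the conditional randomization test is at least d_TV(Q⋆ⁿ(·|Z), Qⁿ(·|Z)) up to an error of order √(log(M)/M).) -/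
open MeasureTheory

open ProbabilityTheory in
/-- **Hoeffding's inequality** for the number of i.i.d. samples that fall in a set. -/
theorem measureReal_pi_card_filter_mem_ge_le {W ι : Type*} [MeasurableSpace W] [Fintype ι]
    (ν : Measure W) [IsProbabilityMeasure ν] {A : Set W} (hA : MeasurableSet A)
    [DecidablePred (· ∈ A)] {t : ℝ} (ht : 0 ≤ t) :
    (Measure.pi fun _ : ι => ν).real
        {x | Fintype.card ι * (ν.real A + t) ≤ (Finset.univ.filter fun i => x i ∈ A).card}
      ≤ Real.exp (-2 * Fintype.card ι * t ^ 2) := by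
  set f : W → ℝ := A.indicator fun _ => 1 with hf
  have hfm : Measurable f := measurable_const.indicator hA
  have hfi : ∫ w, f w ∂ν = ν.real A := by simp [hf, integral_indicator hA]
  have hsub : ∀ i ∈ (Finset.univ : Finset ι),
      HasSubgaussianMGF (fun x : ι → W => f (x i) - ν.real A) ((‖(1 : ℝ) - 0‖₊ / 2) ^ 2)
        (Measure.pi fun _ => ν) := by
    intro i _
    have h := hasSubgaussianMGF_of_mem_Icc (μ := Measure.pi fun _ : ι => ν)
      (X := fun x : ι → W => f (x i)) (a := 0) (b := 1)
      (hfm.comp (measurable_pi_apply i)).aemeasurable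
      (Filter.Eventually.of_forall fun x => by
        by_cases hx : x i ∈ A <;> simp [hf, hx])
    rwa [integral_comp_eval (μ := fun _ : ι => ν) hfm.aestronglyMeasurable, hfi] at h
  have hind : iIndepFun (fun i (x : ι → W) => f (x i) - ν.real A) (Measure.pi fun _ => ν) :=
    iIndepFun_pi (X := fun _ w => f w - ν.real A) fun _ => (hfm.sub_const _).aemeasurable
  have key := HasSubgaussianMGF.measure_sum_ge_le_of_iIndepFun hind hsub
    (ε := Fintype.card ι * t) (by positivity)
  have hsum : ∀ x : ι → W, ∑ i, (f (x i) - ν.real A)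
      = (Finset.univ.filter fun i => x i ∈ A).card - Fintype.card ι * ν.real A := by
    intro x
    simp [hf, Set.indicator_apply, Finset.sum_sub_distrib, Finset.sum_boole]
  simp only [hsum, le_sub_iff_add_le, ← mul_add, add_comm t] at key
  refine key.trans_eq (congrArg Real.exp ?_)
  rcases eq_or_ne (Fintype.card ι : ℝ) 0 with h | h
  · simp [h]
  · simp
    field_simp

/-- The total variation distance is attained by a measurable set. -/
theorem exists_measurableSet_tvDist_le {W : Type*} [MeasurableSpace W] (μ ν : Measure W)
    [IsProbabilityMeasure μ] [IsProbabilityMeasure ν] :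
    ∃ A : Set W, MeasurableSet A ∧ tvDist μ ν ≤ μ.real A - ν.real A := by
  obtain ⟨s, hs, hpos, hneg⟩ := hahn_decomposition μ ν
  have hmax : ∀ B, MeasurableSet B → μ.real B - ν.real B ≤ μ.real s - ν.real s := by
    intro B hB
    have h₁ : ν.real (s \ B) ≤ μ.real (s \ B) :=
      ENNReal.toReal_mono (measure_ne_top _ _) (hpos _ (hs.diff hB) Set.sdiff_subset)
    have h₂ : μ.real (B \ s) ≤ ν.real (B \ s) :=
      ENNReal.toReal_mono (measure_ne_top _ _) (hneg _ (hB.diff hs) fun _ h => h.2)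
    have h₃ := measureReal_inter_add_sdiff (μ := μ) (s := B) hs
    have h₄ := measureReal_inter_add_sdiff (μ := ν) (s := B) hs
    have h₅ := measureReal_inter_add_sdiff (μ := μ) (s := s) hB
    have h₆ := measureReal_inter_add_sdiff (μ := ν) (s := s) hB
    rw [Set.inter_comm] at h₅ h₆
    linarith
  refine ⟨s, hs, ?_⟩
  have : Nonempty {A : Set W // MeasurableSet A} := ⟨⟨s, hs⟩⟩
  refine ciSup_le fun B => abs_le'.2 ⟨hmax B B.2, ?_⟩
  have h := hmax _ B.2.compl
  rw [probReal_compl_eq_one_sub B.2, probReal_compl_eq_one_sub B.2] at h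
  simp only [Measure.real] at h ⊢
  linarith

/-- **Tightness of the robustness bound for the conditional randomization test (Theorem 4).**
Let `W ~ μ` and, independently, `W⁽¹⁾,…,W⁽ᴹ⁾` i.i.d. `~ ν` with `M ≥ 2`. Then there is a
measurable set `A` such that, for the statistic `T = 1_A` and the p-value
`p = (1 + #{m : T(W⁽ᵐ⁾) ≥ T(W)})/(1+M)`, one has
`sup_{α ∈ [0,1]} (P(p ≤ α) − α) ≥ d_TV(μ,ν) − 2.5·√(log M / M)`. -/
theorem crt_robustness_lower_bound {W : Type*} [MeasurableSpace W] (μ ν : Measure W)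
    [IsProbabilityMeasure μ] [IsProbabilityMeasure ν] (M : ℕ) (hM : 2 ≤ M) :
    ∃ A : Set W, MeasurableSet A ∧
      tvDist μ ν - 2.5 * Real.sqrt (Real.log M / M) ≤
        ⨆ α : Set.Icc (0 : ℝ) 1,
          (((μ.prod (Measure.pi fun _ : Fin M => ν))
              {ω | (1 + ((Finset.univ.filter fun m : Fin M =>
                    A.indicator (fun _ => (1 : ℝ)) ω.1
                      ≤ A.indicator (fun _ => (1 : ℝ)) (ω.2 m)).card) : ℝ) / (1 + M)
                ≤ (α : ℝ)}).toReal
            - (α : ℝ)) := by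
  classical
  obtain ⟨A, hA, hTV⟩ := exists_measurableSet_tvDist_le μ ν
  refine ⟨A, hA, ?_⟩
  set q := ν.real A
  set s := Real.sqrt (Real.log M / M) with hs
  have hM2 : (2 : ℝ) ≤ M := by exact_mod_cast hM
  have hlog : 1 / 2 ≤ Real.log M :=
    le_trans (by linarith [Real.log_two_gt_d9]) (Real.log_le_log two_pos hM2)
  have hs0 : 0 ≤ s := Real.sqrt_nonneg _
  have hs2 : M * s ^ 2 = Real.log M := by
    rw [hs, Real.sq_sqrt (by positivity)]
    field_simp
  have hinv : 1 / (M : ℝ) ≤ s := by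
    refine Real.le_sqrt_of_sq_le ?_
    rw [div_pow, one_pow, sq, ← div_div]
    gcongr
    rw [div_le_iff₀ (by positivity)]
    nlinarith
  have hq0 : 0 ≤ q := measureReal_nonneg
  have hbdd : BddAbove (Set.range fun α : Set.Icc (0 : ℝ) 1 =>
      (((μ.prod (Measure.pi fun _ : Fin M => ν))
              {ω | (1 + ((Finset.univ.filter fun m : Fin M =>
                    A.indicator (fun _ => (1 : ℝ)) ω.1
                      ≤ A.indicator (fun _ => (1 : ℝ)) (ω.2 m)).card) : ℝ) / (1 + M)
                ≤ (α : ℝ)}).toReal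
            - (α : ℝ))) := by
    refine ⟨1, ?_⟩
    rintro _ ⟨α, rfl⟩
    exact (sub_le_self _ α.2.1).trans measureReal_le_one
  rcases le_total (q + s + 1 / M) 1 with hα | hα
  · refine le_ciSup_of_le hbdd ⟨q + s + 1 / M, by positivity, hα⟩ ?_
    set P := Measure.pi fun _ : Fin M => ν
    set bad : Set (Fin M → W) :=
      {x | M * (q + s) ≤ (Finset.univ.filter fun i => x i ∈ A).card} with hbad
    have hP : P.real bad ≤ 1 / M * (1 / M) := by
      have h := measureReal_pi_card_filter_mem_ge_le (ι := Fin M) ν hA hs0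
      rw [Fintype.card_fin] at h
      refine h.trans_eq ?_
      rw [mul_assoc, hs2, neg_mul, two_mul, Real.exp_neg, Real.exp_add,
        Real.exp_log (by positivity)]
      field_simp
    have hgood : 1 - P.real bad ≤ P.real badᶜ := by
      have h := measureReal_union_le (μ := P) bad badᶜ
      rw [Set.union_compl_self, probReal_univ] at h
      linarith
    have hrect : μ.real A * P.real badᶜ ≤ (μ.prod P).real
        {ω | (1 + ((Finset.univ.filter fun m : Fin M =>
                    A.indicator (fun _ => (1 : ℝ)) ω.1
                      ≤ A.indicator (fun _ => (1 : ℝ)) (ω.2 m)).card) : ℝ) / (1 + M)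
                ≤ q + s + 1 / M} := by
      rw [← measureReal_prod_prod]
      refine measureReal_mono ?_
      rintro ⟨w, x⟩ ⟨hw, hx⟩
      have hfil : (Finset.univ.filter fun m : Fin M =>
          A.indicator (fun _ => (1 : ℝ)) w ≤ A.indicator (fun _ => (1 : ℝ)) (x m))
          = Finset.univ.filter fun m => x m ∈ A := by
        ext m
        by_cases hm : x m ∈ A <;> simp [show w ∈ A from hw, hm, Set.indicator_apply]
      have hx' : ((Finset.univ.filter fun m => x m ∈ A).card : ℝ) ≤ M * (q + s) :=
        (not_le.1 fun h => hx h).le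
      simp only [Set.mem_ofPred_eq, hfil]
      rw [div_le_iff₀ (by positivity)]
      have : (1 / M : ℝ) * M = 1 := by field_simp
      have : (0 : ℝ) ≤ 1 / M := by positivity
      nlinarith
    have hμ1 : μ.real A ≤ 1 := measureReal_le_one
    have hμ0 : 0 ≤ μ.real A := measureReal_nonneg
    have hb0 : 0 ≤ P.real bad := measureReal_nonneg
    have hhalf : 1 / (M : ℝ) ≤ 1 / 2 := one_div_le_one_div_of_le two_pos hM2
    have hinv0 : 0 ≤ 1 / (M : ℝ) := by positivity
    have h₁ : μ.real A - P.real bad ≤ μ.real A * P.real badᶜ := by nlinarith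
    have h₂ : P.real bad ≤ 1 / 2 * s := hP.trans (mul_le_mul hhalf hinv hinv0 (by norm_num))
    change _ ≤ (μ.prod P).real _ - _
    refine le_trans ?_ (sub_le_sub_right (h₁.trans hrect) _)
    linarith
  · refine le_ciSup_of_le hbdd ⟨1, by simp⟩ ?_
    have hle : ∀ k : Finset (Fin M), (1 + (k.card : ℝ)) / (1 + M) ≤ 1 := by
      intro k
      rw [div_le_one (by positivity)]
      have : (k.card : ℝ) ≤ M := by exact_mod_cast k.card_le_univ.trans_eq (Fintype.card_fin M)
      linarith
    have hμ1 : μ.real A ≤ 1 := measureReal_le_one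
    simp only [hle, Set.ofPred_true, measure_univ, ENNReal.toReal_one]
    linarith
end

section
/- Let h(u) = (1+u)·log(1+u) − u for u > −1, and for an integer M ≥ 2 set c_M = 0.5·√(log(M)/M)·(M+1) − 1. Then c_M/(M/4) > −1, and exp{ −(M/4)·h( c_M/(M/4) ) } ≤ 2·√(log(M)/M). -/
/-- The function `h(u) = (1+u)·log(1+u) − u` appearing in Bennett's inequality. -/
noncomputable def bennettH (u : ℝ) : ℝ := (1 + u) * Real.log (1 + u) - u

open Real in
/-- Third-order Taylor lower bound for `h`. -/
lemma sq_half_sub_cube_sixth_le_bennettH {u : ℝ} (hu : 0 ≤ u) :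
    u ^ 2 / 2 - u ^ 3 / 6 ≤ bennettH u := by
  have hlog := sum_range_le_log_div (x := u / (u + 2)) (by positivity)
    ((div_lt_one (by positivity)).2 (by linarith)) 2
  have harg : (1 + u / (u + 2)) / (1 - u / (u + 2)) = 1 + u := by
    field_simp
    ring
  rw [harg] at hlog
  simp only [Finset.sum_range_succ, Finset.sum_range_zero] at hlog
  norm_num at hlog
  have hmul := mul_le_mul_of_nonneg_left hlog (show 0 ≤ 2 * (1 + u) by positivity)
  have hrat : 2 * (1 + u) * (u / (u + 2) + (u / (u + 2)) ^ 3 / 3) - u - (u ^ 2 / 2 - u ^ 3 / 6)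
      = (4 * u ^ 4 + 3 * u ^ 5 + u ^ 6) / (6 * (u + 2) ^ 3) := by
    field_simp
    ring
  have hrem : 0 ≤ (4 * u ^ 4 + 3 * u ^ 5 + u ^ 6) / (6 * (u + 2) ^ 3) := by positivity
  unfold bennettH
  linarith

lemma bennettH_nonneg {u : ℝ} (hu : -1 < u) : 0 ≤ bennettH u := by
  have hpos : 0 < 1 + u := by linarith
  have hmul := mul_le_mul_of_nonneg_left (Real.one_sub_inv_le_log_of_pos hpos) hpos.le
  rw [mul_sub, mul_inv_cancel₀ hpos.ne'] at hmul
  unfold bennettH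
  linarith

lemma quarter_le_log {M : ℕ} (hM : 2 ≤ M) (hM' : M ≤ 8) : (M : ℝ) / 4 ≤ Real.log M := by
  have h2 := Real.log_two_gt_d9
  have h3 := Real.log_three_gt_d9
  have h5 := Real.log_five_gt_d9
  have h4 : Real.log 4 = 2 * Real.log 2 := by
    rw [show (4 : ℝ) = 2 ^ 2 by norm_num, Real.log_pow]; norm_num
  have h6 : Real.log 6 = Real.log 2 + Real.log 3 := by
    rw [← Real.log_mul] <;> norm_num
  have h7 : Real.log 6 ≤ Real.log 7 := Real.log_le_log (by norm_num) (by norm_num)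
  have h8 : Real.log 8 = 3 * Real.log 2 := by
    rw [show (8 : ℝ) = 2 ^ 3 by norm_num, Real.log_pow]; norm_num
  interval_cases M <;> norm_num <;> linarith

lemma log_mul_sqrt_log_div_le {x : ℝ} (hx : 1 ≤ x) :
    Real.log x * Real.sqrt (Real.log x / x) ≤ 1.16 := by
  have hL : 0 ≤ Real.log x := Real.log_nonneg hx
  have hx0 : 0 < x := by linarith
  have hexp : 2.718 * (Real.log x / 3) ≤ Real.exp (Real.log x / 3) := by
    have h1 := Real.add_one_le_exp (Real.log x / 3 - 1)
    have h2 : Real.exp (Real.log x / 3) = Real.exp 1 * Real.exp (Real.log x / 3 - 1) := by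
      rw [← Real.exp_add]; ring_nf
    rw [h2]
    have := Real.exp_one_gt_d9
    exact mul_le_mul (by linarith) (by linarith) (by positivity) (by positivity)
  have hcube : (2.718 * (Real.log x / 3)) ^ 3 ≤ x := by
    calc _ ≤ Real.exp (Real.log x / 3) ^ 3 := by gcongr
      _ = Real.exp (Real.log x) := by rw [← Real.exp_nat_mul]; norm_num; ring_nf
      _ = x := Real.exp_log hx0
  refine le_of_sq_le_sq ?_ (by norm_num)
  rw [mul_pow, Real.sq_sqrt (by positivity), mul_div_assoc', div_le_iff₀ hx0]
  nlinarith [pow_nonneg hL 3]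

lemma log_div_self_le {a x : ℝ} (ha : 3 ≤ a) (hx : a ≤ x) :
    Real.log x / x ≤ Real.log a / a := by
  have := Real.exp_one_lt_d9
  exact Real.log_div_self_antitoneOn (by simp only [Set.mem_Ici]; linarith)
    (by simp only [Set.mem_Ici]; linarith) hx

/-- The elementary inequality left after inserting the Taylor bound for `h`. -/
lemma remainder_nonneg {x : ℝ} (hx : 9 ≤ x) (e : ℝ) (he : e = Real.sqrt (Real.log x / x)) :
    0 ≤ Real.log 2 + Real.log (Real.log x) / 2 + e ^ 2 - 2 * e + 2 * (1 - e) / x - 1.16 / 3 := by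
  have hl2 := Real.log_two_gt_d9
  have hl2' := Real.log_two_lt_d9
  have hl3 := Real.log_three_gt_d9
  have hl3' := Real.log_three_lt_d9
  rcases le_total x 16 with h16 | h16
  · have h9 : Real.log 9 = 2 * Real.log 3 := by
      rw [show (9 : ℝ) = 3 ^ 2 by norm_num, Real.log_pow]; norm_num
    have hloglog : 0.78 ≤ Real.log (Real.log x) := by
      have hle : 2 * Real.log 3 ≤ Real.log x := h9 ▸ Real.log_le_log (by norm_num) hx
      have h1 := Real.log_le_log (by positivity) hle
      rw [Real.log_mul (by norm_num) (by linarith)] at h1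
      have h2 := Real.one_sub_inv_le_log_of_pos (show (0 : ℝ) < 1.098 by norm_num)
      have h3 := Real.log_le_log (by norm_num) (show (1.098 : ℝ) ≤ Real.log 3 by linarith)
      norm_num at *
      linarith
    have he' : e ≤ 0.4942 := by
      rw [he]
      refine Real.sqrt_le_iff.2 ⟨by norm_num, ?_⟩
      have := log_div_self_le (by norm_num) hx
      rw [h9] at this
      linarith
    have htail : 0.0632 ≤ 2 * (1 - e) / x := by
      rw [le_div_iff₀ (by linarith)]; linarith
    nlinarith
  · have hlog16 : Real.log 16 = 4 * Real.log 2 := by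
      rw [show (16 : ℝ) = 2 ^ 4 by norm_num, Real.log_pow]; norm_num
    have hloglog : 1 ≤ Real.log (Real.log x) := by
      have hle : Real.log 16 ≤ Real.log x := Real.log_le_log (by norm_num) h16
      have := Real.exp_one_lt_d9
      rw [Real.le_log_iff_exp_le (by linarith)]
      linarith
    have he' : e ≤ 0.4163 := by
      rw [he]
      refine Real.sqrt_le_iff.2 ⟨by norm_num, ?_⟩
      have := log_div_self_le (by norm_num) h16
      rw [hlog16] at this
      linarith
    have htail : 0 ≤ 2 * (1 - e) / x := div_nonneg (by linarith) (by linarith)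
    nlinarith

/-- **Explicit numerical bound on the Bennett exponential term.**
For every integer `M ≥ 2`, with `c_M = 0.5·√(log M / M)·(M+1) − 1`, the argument
`c_M/(M/4)` exceeds `−1` and `exp(−(M/4)·h(c_M/(M/4))) ≤ 2·√(log M / M)`. -/
theorem bennett_term_explicit_bound (M : ℕ) (hM : 2 ≤ M)
    (cM : ℝ) (hcM : cM = 0.5 * Real.sqrt (Real.log M / M) * ((M : ℝ) + 1) - 1) :
    -1 < cM / ((M : ℝ) / 4) ∧
      Real.exp (-((M : ℝ) / 4) * bennettH (cM / ((M : ℝ) / 4)))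
        ≤ 2 * Real.sqrt (Real.log M / M) := by
  have hM2 : (2 : ℝ) ≤ M := by exact_mod_cast hM
  have hM0 : (0 : ℝ) < M := by linarith
  have hL : 0 < Real.log M := Real.log_pos (by linarith)
  set e := Real.sqrt (Real.log M / M) with he
  have he0 : 0 < e := Real.sqrt_pos.2 (by positivity)
  have hesq : e ^ 2 = Real.log M / M := Real.sq_sqrt (by positivity)
  have hmesq : M * e ^ 2 = Real.log M := by rw [hesq]; field_simp
  set u := cM / ((M : ℝ) / 4) with hu
  rcases le_or_gt M 8 with hM8 | hM9
  · have he2 : 1 / 2 ≤ e := by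
      refine Real.le_sqrt_of_sq_le ?_
      rw [le_div_iff₀ hM0]
      linarith [quarter_le_log hM hM8]
    have hu1 : -1 < u := by
      rw [hu, lt_div_iff₀ (by positivity), hcM]
      nlinarith
    refine ⟨hu1, ?_⟩
    have hle : -((M : ℝ) / 4) * bennettH u ≤ 0 := by
      have := mul_nonneg hM0.le (bennettH_nonneg hu1)
      linarith
    linarith [Real.exp_le_one_iff.2 hle]
  · have hM9' : (9 : ℝ) ≤ M := by exact_mod_cast hM9
    have hLM : Real.log M ≤ M := (Real.log_le_sub_one_of_pos hM0).trans (by linarith)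
    have he1 : e ≤ 1 := Real.sqrt_le_one.2 ((div_le_one hM0).2 hLM)
    have hL2 : 2 ≤ Real.log M := by
      have h9 : Real.log (3 ^ 2) ≤ Real.log M := Real.log_le_log (by norm_num) (by linarith)
      rw [Real.log_pow] at h9
      push_cast at h9
      linarith [Real.log_three_gt_d9]
    have hueq : u = 2 * (e * (M + 1) - 2) / M := by
      rw [hu, hcM]
      field_simp
      ring
    have heM : 2 ≤ e * (M + 1) := by
      refine le_of_sq_le_sq ?_ (by positivity)
      nlinarith
    have hu0 : 0 ≤ u := by
      rw [hueq]
      exact div_nonneg (by linarith) hM0.le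
    refine ⟨by linarith, ?_⟩
    have hu2 : u ≤ 2 * e := by
      rw [hueq, div_le_iff₀ hM0]
      linarith
    have hsq : M / 8 * u ^ 2
        = Real.log M / 2 + e ^ 2 - 2 * e + 2 * (1 - e) / M + e ^ 2 / (2 * M) := by
      rw [hueq, ← hmesq]
      field_simp
      ring
    have hcube : M / 24 * u ^ 3 ≤ 1.16 / 3 := by
      calc M / 24 * u ^ 3 ≤ M / 24 * (2 * e) ^ 3 := by gcongr
        _ = Real.log M * e / 3 := by rw [← hmesq]; ring
        _ ≤ 1.16 / 3 := by
          have := log_mul_sqrt_log_div_le (x := M) (by linarith)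
          gcongr
    have hh := mul_le_mul_of_nonneg_left (sq_half_sub_cube_sixth_le_bennettH hu0)
      (show (0 : ℝ) ≤ M / 4 by positivity)
    have hrem := remainder_nonneg hM9' e he
    have hpos : 0 ≤ e ^ 2 / (2 * M) := by positivity
    have hlog : Real.log (2 * e)
        = Real.log 2 + (Real.log (Real.log M) - Real.log M) / 2 := by
      rw [Real.log_mul (by norm_num) he0.ne', he, Real.log_sqrt (by positivity),
        Real.log_div hL.ne' hM0.ne']
    rw [← Real.le_log_iff_exp_le (by positivity), hlog]
    linarith
end

section
/- Let h(u) = (1+u)·log(1+u) − u for u > −1, and for an integer M ≥ 2 set c_M = 0.5·√(log(M)/M)·(M+1) − 1. Then (M/4)·h( c_M/(M/4) ) − (1/2)·log(M) → 0 as M → ∞; equivalently, √M · exp{ −(M/4)·h( c_M/(M/4) ) } → 1 as M → ∞. -/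
/-- Second-order Taylor expansion of `bennettH` at `0`, with an explicit cubic error. -/
theorem abs_bennettH_sub_sq_div_two_le {u : ℝ} (hu : |u| ≤ 1 / 2) :
    |bennettH u - u ^ 2 / 2| ≤ 4 * |u| ^ 3 := by
  have hlog := Real.abs_log_sub_add_sum_range_le (x := -u) (by rw [abs_neg]; linarith) 2
  simp only [Finset.sum_range_succ, Finset.sum_range_zero, abs_neg, sub_neg_eq_add] at hlog
  norm_num at hlog
  set R := -u + u ^ 2 / 2 + Real.log (1 + u) with hR
  have hR2 : |R| ≤ 2 * |u| ^ 3 := by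
    refine hlog.trans ?_
    rw [div_le_iff₀ (by linarith)]
    nlinarith [pow_nonneg (abs_nonneg u) 3]
  have hsplit : bennettH u - u ^ 2 / 2 = (1 + u) * R - u ^ 3 / 2 := by
    rw [bennettH, hR]; ring
  have hfactor : |1 + u| ≤ 3 / 2 := (abs_add_le 1 u).trans (by rw [abs_one]; linarith)
  calc |bennettH u - u ^ 2 / 2| ≤ |(1 + u) * R| + |u ^ 3 / 2| := by
        rw [hsplit]; exact abs_sub _ _
    _ = |1 + u| * |R| + |u| ^ 3 / 2 := by rw [abs_mul, abs_div, abs_pow, abs_two]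
    _ ≤ 3 / 2 * (2 * |u| ^ 3) + |u| ^ 3 / 2 := by gcongr
    _ ≤ 4 * |u| ^ 3 := by linarith [pow_nonneg (abs_nonneg u) 3]

open Filter Topology in
theorem tendsto_log_pow_div_natCast (k : ℕ) :
    Tendsto (fun M : ℕ => Real.log M ^ k / (M : ℝ)) atTop (𝓝 0) := by
  have h := (isLittleO_log_rpow_rpow_atTop (k : ℝ) (zero_lt_one' ℝ)).tendsto_div_nhds_zero
  simpa [Function.comp_def] using h.comp tendsto_natCast_atTop_atTop

open Filter Topology in
theorem tendsto_bennett_exponent_sub_half_log :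
    Tendsto
      (fun M : ℕ => ((M : ℝ) / 4)
          * bennettH ((0.5 * Real.sqrt (Real.log M / M) * ((M : ℝ) + 1) - 1) / ((M : ℝ) / 4))
        - (1 / 2) * Real.log M)
      atTop (𝓝 0) := by
  set s : ℕ → ℝ := fun M => Real.sqrt (Real.log M / M) with hs
  set t : ℕ → ℝ := fun M => (M : ℝ)⁻¹ with ht
  set u : ℕ → ℝ := fun M =>
    (0.5 * Real.sqrt (Real.log M / M) * ((M : ℝ) + 1) - 1) / ((M : ℝ) / 4) with hu
  have t0 : Tendsto t atTop (𝓝 0) := tendsto_inv_atTop_nhds_zero_nat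
  have s0 : Tendsto s atTop (𝓝 0) := by
    simpa only [pow_one, Real.sqrt_zero] using (tendsto_log_pow_div_natCast 1).sqrt
  have cube0 : Tendsto (fun M : ℕ => (M : ℝ) * s M ^ 3) atTop (𝓝 0) := by
    have h := (tendsto_log_pow_div_natCast 3).sqrt
    rw [Real.sqrt_zero] at h
    refine h.congr' ?_
    filter_upwards [eventually_ge_atTop 1] with M hM
    have hM' : (1 : ℝ) ≤ M := by exact_mod_cast hM
    have hL := Real.log_nonneg hM'
    have hsq : s M ^ 2 = Real.log M / M := Real.sq_sqrt (by positivity)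
    rw [Real.sqrt_eq_iff_mul_self_eq (by positivity) (by positivity)]
    calc Real.log M ^ 3 / M = M ^ 2 * (s M ^ 2) ^ 3 := by rw [hsq]; field_simp
      _ = M * s M ^ 3 * (M * s M ^ 3) := by ring
  have u_eq : ∀ᶠ M in atTop, u M = s M * (2 + 2 * t M) - 4 * t M := by
    filter_upwards [eventually_ge_atTop 1] with M hM
    have hM' : (M : ℝ) ≠ 0 := by positivity
    simp only [hu, hs, ht]
    field_simp
    ring
  have a2 : Tendsto (fun M => 2 + 2 * t M) atTop (𝓝 2) := by
    simpa using (t0.const_mul 2).const_add 2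
  have u0 : Tendsto u atTop (𝓝 0) := by
    have h := (s0.mul a2).sub (t0.const_mul 4)
    simp only [zero_mul, mul_zero, sub_zero] at h
    exact h.congr' (u_eq.mono fun _ h => h.symm)
  have quad0 : Tendsto (fun M : ℕ => (M : ℝ) / 4 * (u M ^ 2 / 2) - 1 / 2 * Real.log M)
      atTop (𝓝 0) := by
    have h : Tendsto (fun M => s M ^ 2 + s M ^ 2 * t M / 2 - s M * (2 + 2 * t M) + 2 * t M)
        atTop (𝓝 (0 ^ 2 + 0 ^ 2 * 0 / 2 - 0 * 2 + 2 * 0)) :=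
      (((s0.pow 2).add (((s0.pow 2).mul t0).div_const 2)).sub (s0.mul a2)).add (t0.const_mul 2)
    norm_num at h
    refine h.congr' ?_
    filter_upwards [eventually_ge_atTop 1, u_eq] with M hM hue
    have hM' : (1 : ℝ) ≤ M := by exact_mod_cast hM
    have hL := Real.log_nonneg hM'
    have hsq : s M ^ 2 = Real.log M / M := Real.sq_sqrt (by positivity)
    have hlog : Real.log M = M * s M ^ 2 := by rw [hsq]; field_simp
    rw [hue, hlog]
    simp only [ht]
    field_simp
    ring
  have rem0 : Tendsto (fun M : ℕ => (M : ℝ) * u M ^ 3) atTop (𝓝 0) := by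
    have h : Tendsto (fun M : ℕ => (M : ℝ) * s M ^ 3 * (2 + 2 * t M) ^ 3
        - 12 * (s M ^ 2 * (2 + 2 * t M) ^ 2) + 48 * (s M * (2 + 2 * t M) * t M) - 64 * t M ^ 2)
        atTop (𝓝 (0 * 2 ^ 3 - 12 * (0 ^ 2 * 2 ^ 2) + 48 * (0 * 2 * 0) - 64 * 0 ^ 2)) :=
      (((cube0.mul (a2.pow 3)).sub (((s0.pow 2).mul (a2.pow 2)).const_mul 12)).add
        (((s0.mul a2).mul t0).const_mul 48)).sub ((t0.pow 2).const_mul 64)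
    norm_num at h
    refine h.congr' ?_
    filter_upwards [eventually_ge_atTop 1, u_eq] with M hM hue
    have hM' : (M : ℝ) ≠ 0 := by positivity
    rw [hue]
    simp only [ht]
    field_simp
    ring
  have err0 : Tendsto (fun M : ℕ => (M : ℝ) / 4 * (bennettH (u M) - u M ^ 2 / 2))
      atTop (𝓝 0) := by
    refine squeeze_zero_norm' ?_ (by simpa using rem0.abs)
    have hsmall : ∀ᶠ M in atTop, |u M| < 1 / 2 :=
      (by simpa using u0.abs : Tendsto (fun M => |u M|) atTop (𝓝 0)).eventually_lt_const
        (by norm_num)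
    filter_upwards [hsmall] with M hM
    have hM0 : (0 : ℝ) ≤ M := M.cast_nonneg
    rw [Real.norm_eq_abs, abs_mul, abs_of_nonneg (by positivity : (0 : ℝ) ≤ M / 4)]
    calc (M : ℝ) / 4 * |bennettH (u M) - u M ^ 2 / 2| ≤ M / 4 * (4 * |u M| ^ 3) := by
          gcongr; exact abs_bennettH_sub_sq_div_two_le hM.le
      _ = M * |u M| ^ 3 := by ring
  have h := err0.add quad0
  rw [add_zero] at h
  exact h.congr fun M => by ring

/-- **Asymptotics of the Bennett exponential term.**
With `c_M = 0.5·√(log M / M)·(M+1) − 1`, as `M → ∞` one has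
`(M/4)·h(c_M/(M/4)) − (1/2)·log M → 0`; equivalently,
`√M · exp(−(M/4)·h(c_M/(M/4))) → 1`. -/
theorem bennett_term_asymptotics :
    Filter.Tendsto
      (fun M : ℕ => ((M : ℝ) / 4)
          * bennettH ((0.5 * Real.sqrt (Real.log M / M) * ((M : ℝ) + 1) - 1) / ((M : ℝ) / 4))
        - (1 / 2) * Real.log M)
      Filter.atTop (nhds 0) ∧
    Filter.Tendsto
      (fun M : ℕ => Real.sqrt M * Real.exp (-(((M : ℝ) / 4)
          * bennettH ((0.5 * Real.sqrt (Real.log M / M) * ((M : ℝ) + 1) - 1) / ((M : ℝ) / 4)))))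
      Filter.atTop (nhds 1) := by
  refine ⟨tendsto_bennett_exponent_sub_half_log, ?_⟩
  have h := tendsto_bennett_exponent_sub_half_log.neg.rexp
  rw [neg_zero, Real.exp_zero] at h
  refine h.congr' ?_
  filter_upwards [Filter.eventually_ge_atTop 1] with M hM
  have hM' : (0 : ℝ) < M := by positivity
  rw [← Real.exp_log (Real.sqrt_pos.2 hM'), Real.log_sqrt hM'.le, ← Real.exp_add]
  congr 1
  ring
end
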